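/- arXiv:1405.6700 — 4 statements merged into one kernel-verified Lean document; each statement's English description precedes it below -/
import Mathlib

section
/- Let n ≥ 2, r > 0, and let X = {x ∈ ℝⁿ : ‖x‖ ≤ r} be the closed Euclidean ball with the subspace topology. Let F = (W,R,R_D) be a finite rooted DT1CK-frame and w' ∈ W with w' R w'. Then there exists a surjective f : X → W such that: (i) d_X(f⁻¹(w)) = f⁻¹(R⁻¹(w)) for every w ∈ W, where d_X is the derived-set operation of the subspace X; (ii) f(x) R_D f(y) whenever x ≠ y in X; (iii) whenever f(x) R_D w there exists y ∈ X with y ≠ x and f(y) = w; and (iv) f(x) = w' for every x with ‖x‖ = r. -/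
/-- A finite rooted DT1CK-frame `(W, R, R_D)` (finiteness and nonemptiness of
`W` are assumed separately as instances). -/
structure IsDT1CKFrame {W : Type*} (R RD : W → W → Prop) : Prop where
  trans : Transitive R
  serial : ∀ x : W, ∃ y, R x y
  sub : ∀ x y : W, R x y → RD x y
  diff : ∀ x y : W, x ≠ y → RD x y
  irrefl_min : ∀ x : W, ¬ RD x x → ∀ v, ¬ R v x
  rooted : ∃ r : W, ∀ w, w = r ∨ R r w
  conn : ∀ x y : W,
    Relation.ReflTransGen (fun a b => R a b ∨ R b a ∨ a = b) x y
  ku : ∀ x : W, ¬ R x x → ∀ y z, R x y → R x z →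
    Relation.ReflTransGen
      (fun a b => (R a b ∨ R b a ∨ a = b) ∧ R x a ∧ R x b) y z

open Set Filter Topology Metric

section Local

variable {W E : Type*} [TopologicalSpace E]

/-- `f` satisfies the defining condition of a d-morphism into `(W, R)` at the point `x`: close to
`x`, but off `x`, the values of `f` are exactly the `R`-successors of `f x`. -/
def DMorphAt (R : W → W → Prop) (f : E → W) (x : E) : Prop :=
  (∀ᶠ y in 𝓝[≠] x, R (f x) (f y)) ∧ ∀ w, R (f x) w → ∃ᶠ y in 𝓝[≠] x, f y = w

theorem DMorphAt.congr {R : W → W → Prop} {f g : E → W} {x : E} (hg : DMorphAt R g x)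
    (h : f =ᶠ[𝓝 x] g) : DMorphAt R f x := by
  have hx : f x = g x := h.eq_of_nhds
  have h' : f =ᶠ[𝓝[≠] x] g := h.filter_mono nhdsWithin_le_nhds
  refine ⟨?_, fun w hw => ?_⟩
  · filter_upwards [hg.1, h'] with y hy hfy
    rwa [hx, hfy]
  · rw [hx] at hw
    refine ((hg.2 w hw).and_eventually h').mono ?_
    rintro y ⟨hy, hfy⟩
    rw [hfy, hy]

theorem DMorphAt.congr_of_isOpen {R : W → W → Prop} {f g : E → W} {x : E} {U : Set E}
    (hg : DMorphAt R g x) (hU : IsOpen U) (hx : x ∈ U) (h : ∀ y ∈ U, f y = g y) :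
    DMorphAt R f x :=
  hg.congr (Filter.eventually_of_mem (hU.mem_nhds hx) h)

end Local

/-- A sequence that visits every element of a countable type infinitely often. -/
theorem exists_seq_visiting_infinitely_often (α : Type*) [Countable α] [Nonempty α] :
    ∃ e : ℕ → α, ∀ a N, ∃ k, N ≤ k ∧ e k = a := by
  obtain ⟨u, hu⟩ := exists_surjective_nat α
  refine ⟨fun k => u k.unpair.1, fun a N => ?_⟩
  obtain ⟨i, rfl⟩ := hu a
  exact ⟨Nat.pair i N, Nat.right_le_pair i N, by simp⟩

theorem interior_union_subset_of_disjoint {E : Type*} [TopologicalSpace E] {A D : Set E}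
    (hA : IsClosed A) (hD : IsClosed D) (h : Disjoint A D) :
    interior (A ∪ D) ⊆ interior A ∪ interior D := by
  intro x hx
  have hx' := mem_interior_iff_mem_nhds.1 hx
  by_cases hxA : x ∈ A
  · left
    have hxD : x ∉ D := Set.disjoint_left.1 h hxA
    rw [mem_interior_iff_mem_nhds]
    filter_upwards [hx', hD.isOpen_compl.mem_nhds hxD] with y hy hyD
    exact hy.resolve_right hyD
  · right
    rw [mem_interior_iff_mem_nhds]
    filter_upwards [hx', hA.isOpen_compl.mem_nhds hxA] with y hy hyA
    exact hy.resolve_left hyA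

section Annuli

variable {W E : Type*} [MetricSpace E]

theorem isOpen_setOf_dist_lt (p : E) (t : ℝ) : IsOpen {x | dist x p < t} :=
  isOpen_lt (by fun_prop) continuous_const

theorem isOpen_setOf_lt_dist (p : E) (t : ℝ) : IsOpen {x | t < dist x p} :=
  isOpen_lt continuous_const (by fun_prop)

/-- Two functions that agree on an open annulus can be glued along it. -/
theorem exists_dMorph_glue {R : W → W → Prop} {F₁ F₂ : E → W} (h₁ : ∀ x, DMorphAt R F₁ x)
    (h₂ : ∀ x, DMorphAt R F₂ x) {p : E} {t₁ t₂ : ℝ} (ht : t₁ < t₂)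
    (h : ∀ x, t₁ < dist x p → dist x p < t₂ → F₁ x = F₂ x) :
    ∃ F : E → W, (∀ x, DMorphAt R F x) ∧ (∀ x, t₁ < dist x p → F x = F₁ x) ∧
      ∀ x, dist x p < t₂ → F x = F₂ x := by
  classical
  let F : E → W := fun x => if dist x p < t₂ then F₂ x else F₁ x
  have hF₂ : ∀ x, dist x p < t₂ → F x = F₂ x := fun x hx => if_pos hx
  have hF₁ : ∀ x, t₁ < dist x p → F x = F₁ x := by
    intro x hx
    by_cases hx' : dist x p < t₂
    · rw [hF₂ x hx', h x hx hx']
    · exact if_neg hx'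
  refine ⟨F, fun x => ?_, hF₁, hF₂⟩
  by_cases hx : dist x p < t₂
  · exact (h₂ x).congr_of_isOpen (isOpen_setOf_dist_lt p t₂) hx hF₂
  · exact (h₁ x).congr_of_isOpen (isOpen_setOf_lt_dist p t₁) (ht.trans_le (not_lt.1 hx)) hF₁

/-- Inside an arbitrary annulus one can pass, with values in `V`, from the background `base m`
outside to the background `base m'` inside, visiting every value in `Z` on the way. -/
def HasTransition (R : W → W → Prop) (base : W → E → W) (V : Set W) (m m' : W) (Z : Set W) : Prop :=
  ∀ (p : E) (s r : ℝ), 0 < s → s < r → ∃ F : E → W, (∀ x, DMorphAt R F x) ∧ (∀ x, F x ∈ V) ∧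
    (∀ x, r ≤ dist x p → F x = base m x) ∧ (∀ x, dist x p ≤ s → F x = base m' x) ∧
    ∀ w ∈ Z, ∃ x, s < dist x p ∧ dist x p < r ∧ F x = w

/-- The generated subframe of `y` can be realised inside an arbitrary ball on the background
`base m`; an irreflexive `y` is taken only once. -/
def HasInsertion (R : W → W → Prop) (base : W → E → W) (y m : W) : Prop :=
  ∀ (p : E) (ρ : ℝ), 0 < ρ → ∃ f : E → W, (∀ x, DMorphAt R f x) ∧ (∀ x, f x = y ∨ R y (f x)) ∧
    (∀ x, ρ ≤ dist x p → f x = base m x) ∧ (∃ x ∈ ball p ρ, f x = y) ∧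
    (¬ R y y → ∀ x x', f x = y → f x' = y → x = x')

theorem HasTransition.mono {R : W → W → Prop} {base : W → E → W} {V V' Z : Set W} {m m' : W}
    (h : HasTransition R base V m m' Z) (hV : V ⊆ V') : HasTransition R base V' m m' Z := by
  intro p s r hs hsr
  obtain ⟨F, h1, h2, h3⟩ := h p s r hs hsr
  exact ⟨F, h1, fun x => hV (h2 x), h3⟩

theorem HasTransition.comp {R : W → W → Prop} {base : W → E → W} {V Z Z' : Set W} {m m' m'' : W}
    (h : HasTransition R base V m m' Z) (h' : HasTransition R base V m' m'' Z') :
    HasTransition R base V m m'' (Z ∪ Z') := by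
  intro p s r hs hsr
  obtain ⟨t₁, hst₁, ht₁r⟩ := exists_between hsr
  obtain ⟨t₂, ht₁₂, ht₂r⟩ := exists_between ht₁r
  obtain ⟨F₁, g₁, v₁, o₁, i₁, z₁⟩ := h p t₂ r (by linarith) ht₂r
  obtain ⟨F₂, g₂, v₂, o₂, i₂, z₂⟩ := h' p s t₁ hs hst₁
  obtain ⟨F, gF, hF₁, hF₂⟩ := exists_dMorph_glue g₁ g₂ ht₁₂
    (fun x hx hx' => by rw [i₁ x hx'.le, o₂ x hx.le])
  refine ⟨F, gF, fun x => ?_, fun x hx => ?_, fun x hx => ?_, ?_⟩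
  · rcases lt_or_ge (dist x p) t₂ with hx | hx
    · rw [hF₂ x hx]; exact v₂ x
    · rw [hF₁ x (by linarith)]; exact v₁ x
  · rw [hF₁ x (by linarith), o₁ x hx]
  · rw [hF₂ x (by linarith), i₂ x hx]
  · rintro w (hw | hw)
    · obtain ⟨x, hx, hx', hFx⟩ := z₁ w hw
      exact ⟨x, by linarith, hx', by rw [hF₁ x (by linarith), hFx]⟩
    · obtain ⟨x, hx, hx', hFx⟩ := z₂ w hw
      exact ⟨x, hx, by linarith, by rw [hF₂ x (by linarith), hFx]⟩

theorem wellFounded_strictSuccessor [Finite W] {R : W → W → Prop}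
    (htrans : ∀ ⦃x y z⦄, R x y → R y z → R x z) :
    WellFounded fun z y : W => R y z ∧ ¬ R z y := by
  have : IsTrans W fun z y => R y z ∧ ¬ R z y :=
    ⟨fun a b c hab hbc => ⟨htrans hbc.1 hab.1, fun h => hab.2 (htrans h hbc.1)⟩⟩
  have : Std.Irrefl fun z y : W => R y z ∧ ¬ R z y := ⟨fun a h => h.2 h.1⟩
  exact Finite.wellFounded_of_trans_of_irrefl _

theorem exists_maximal_successor [Finite W] {R : W → W → Prop}
    (htrans : ∀ ⦃x y z⦄, R x y → R y z → R x z) (hserial : ∀ x, ∃ y, R x y) (y : W) :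
    ∃ m, R y m ∧ ∀ z, R m z → R z m := by
  obtain ⟨m, hm, hmin⟩ := (wellFounded_strictSuccessor htrans).has_min {m | R y m} (hserial y)
  exact ⟨m, hm, fun z hz => by_contra fun h => hmin z (htrans hm hz) ⟨hz, h⟩⟩

/-- Changes of background above an irreflexive `y` follow the chains in `R(y)`. -/
theorem hasTransition_of_irrefl [Finite W] {R RD : W → W → Prop} (hF : IsDT1CKFrame R RD)
    {base : W → E → W} {y m m' : W} (hy : ¬ R y y)
    (hsucc : ∀ w, R y w → ∀ m m', R w m → (∀ z, R m z → R z m) → R w m' → (∀ z, R m' z → R z m') →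
      HasTransition R base {v | R w v} m m' ∅)
    (hym : R y m) (hm : ∀ z, R m z → R z m) (hym' : R y m') (hm' : ∀ z, R m' z → R z m') :
    HasTransition R base {w | R y w} m m' ∅ := by
  have hsucc' : ∀ w, R y w → ∀ m m', R w m → (∀ z, R m z → R z m) → R w m' →
      (∀ z, R m' z → R z m') → HasTransition R base {v | R y v} m m' ∅ :=
    fun w hw m m' h1 h2 h3 h4 => (hsucc w hw m m' h1 h2 h3 h4).mono fun v hv => hF.trans hw hv
  have hrefl : ∀ m, (∀ z, R m z → R z m) → R m m := by
    intro m hm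
    obtain ⟨z, hz⟩ := hF.serial m
    exact hF.trans hz (hm z hz)
  suffices h : ∀ z, Relation.ReflTransGen
      (fun a b => (R a b ∨ R b a ∨ a = b) ∧ R y a ∧ R y b) m z →
      ∀ k, R z k → (∀ v, R k v → R v k) → HasTransition R base {w | R y w} m k ∅ from
    h m' (hF.ku y hy m m' hym hym') m' (hrefl m' hm') hm'
  intro z hz k hzk hk
  induction hz generalizing k with
  | refl => exact hsucc' m hym m k (hrefl m hm) hm hzk hk
  | @tail b c _ hbc ih =>
    obtain ⟨hbc | hcb | rfl, hyb, hyc⟩ := hbc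
    · exact ih k (hF.trans hbc hzk) hk
    · obtain ⟨l, hbl, hl⟩ := exists_maximal_successor hF.trans hF.serial b
      have := (ih l hbl hl).comp (hsucc' c hyc l k (hF.trans hcb hbl) hl hzk hk)
      rwa [empty_union] at this
    · exact ih k hzk hk

/-- Realisation of an irreflexive `y`: it is the value at the centre of shrinking annuli which visit
all the successors of `y`. -/
theorem hasInsertion_of_irrefl [Countable W] {R : W → W → Prop} (hserial : ∀ x, ∃ y, R x y)
    {base : W → E → W} {y m : W} (hy : ¬ R y y)
    (hloop : ∀ w, R y w → HasTransition R base {v | R y v} m m {w}) :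
    HasInsertion R base y m := by
  classical
  intro p ρ hρ
  have : Nonempty {w // R y w} := let ⟨w, hw⟩ := hserial y; ⟨⟨w, hw⟩⟩
  obtain ⟨e, he⟩ := exists_seq_visiting_infinitely_often {w // R y w}
  let r : ℕ → ℝ := fun k => ρ * (1 / 2) ^ k
  have hr : ∀ k, 0 < r k := fun k => by positivity
  have hrs : ∀ k, r (k + 1) = r k / 2 := fun k => by simp only [r, pow_succ]; ring
  have hr0 : r 0 = ρ := by simp [r]
  have hanti : ∀ {j k}, j < k → r k ≤ r j / 2 := by
    intro j k hjk
    rw [← hrs]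
    exact (antitone_nat_of_succ_le fun k => by linarith [hr k, hrs k]) hjk
  have hlim : Tendsto r atTop (𝓝 0) := by
    simpa [r] using (tendsto_pow_atTop_nhds_zero_of_lt_one (r := (1 / 2 : ℝ)) (by norm_num)
      (by norm_num)).const_mul ρ
  choose F gF vF oF iF zF using fun k => hloop (e k) (e k).2 p (5 / 8 * r k) (7 / 8 * r k)
    (by linarith [hr k]) (by linarith [hr k])
  let D : ℕ → Set E := fun k => {x | 5 / 8 * r k ≤ dist x p ∧ dist x p ≤ 7 / 8 * r k}
  let f : E → W := fun x =>
    if x = p then y else if hx : ∃ k, x ∈ D k then F hx.choose x else base m x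
  have hfp : f p = y := if_pos rfl
  have hfF : ∀ k x, 7 / 16 * r k < dist x p → dist x p < 5 / 4 * r k → f x = F k x := by
    intro k x h1 h2
    have hxp : x ≠ p := by
      rintro rfl
      rw [dist_self] at h1
      linarith [hr k]
    by_cases hex : ∃ k, x ∈ D k
    · have hk : hex.choose = k := by
        obtain ⟨h3, h4⟩ := hex.choose_spec
        rcases lt_trichotomy hex.choose k with h | h | h
        · linarith [hanti h]
        · exact h
        · linarith [hanti h]
      simp only [f, if_neg hxp, dif_pos hex, hk]
    · simp only [f, if_neg hxp, dif_neg hex]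
      have hk : x ∉ D k := fun h => hex ⟨k, h⟩
      rcases le_total (dist x p) (5 / 8 * r k) with h | h
      · rw [iF k x h]
      · rw [oF k x (not_lt.1 fun h' => hk ⟨h, h'.le⟩)]
  have hfo : ∀ x, 7 / 8 * ρ < dist x p → f x = base m x := by
    intro x hx
    have hxp : x ≠ p := by
      rintro rfl
      rw [dist_self] at hx
      linarith
    have hex : ¬ ∃ k, x ∈ D k := by
      rintro ⟨k, -, hk⟩
      rcases Nat.eq_zero_or_pos k with rfl | h
      · linarith
      · linarith [hanti h]
    simp only [f, if_neg hxp, dif_neg hex]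
  have hcover : ∀ x, x ≠ p → ∃ k, f =ᶠ[𝓝 x] F k := by
    intro x hxp
    have hd : 0 < dist x p := dist_pos.2 hxp
    by_cases hx : 7 / 8 * ρ < dist x p
    · refine ⟨0, Filter.eventually_of_mem ((isOpen_setOf_lt_dist p _).mem_nhds hx) ?_⟩
      intro z hz
      rw [hfo z hz, oF 0 z (by rw [hr0]; exact le_of_lt hz)]
    · have hex : ∃ k, 7 / 16 * r k < dist x p := by
        obtain ⟨k, hk⟩ := (hlim.eventually (gt_mem_nhds hd)).exists
        exact ⟨k, by linarith [hr k]⟩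
      have h1 := Nat.find_spec hex
      have h2 : dist x p < 5 / 4 * r (Nat.find hex) := by
        rcases Nat.eq_zero_or_pos (Nat.find hex) with h | h
        · rw [h, hr0]; linarith
        · obtain ⟨j, hj⟩ := Nat.exists_eq_add_of_lt h
          have hmin := Nat.find_min hex (m := j) (by omega)
          have : r (Nat.find hex) = r j / 2 := by rw [hj, zero_add, hrs]
          linarith [hr j]
      refine ⟨Nat.find hex, Filter.eventually_of_mem
        (((isOpen_setOf_lt_dist p _).inter (isOpen_setOf_dist_lt p _)).mem_nhds ⟨h1, h2⟩) ?_⟩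
      exact fun z hz => hfF _ z hz.1 hz.2
  have hfR : ∀ x, x ≠ p → R y (f x) := by
    intro x hx
    obtain ⟨k, hk⟩ := hcover x hx
    rw [hk.eq_of_nhds]
    exact vF k x
  refine ⟨f, fun x => ?_, fun x => ?_, fun x hx => hfo x (by linarith),
    ⟨p, mem_ball_self hρ, hfp⟩, fun _ x x' hx hx' => ?_⟩
  · by_cases hx : x = p
    · subst hx
      refine ⟨?_, fun w hw => ?_⟩
      · rw [hfp]
        filter_upwards [self_mem_nhdsWithin] with z hz using hfR z hz
      · rw [hfp] at hw
        rw [frequently_nhdsWithin_iff, nhds_basis_ball.frequently_iff]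
        intro ε hε
        obtain ⟨N, hN⟩ := eventually_atTop.1 (hlim.eventually (gt_mem_nhds hε))
        obtain ⟨k, hNk, hek⟩ := he ⟨w, hw⟩ N
        obtain ⟨z, hz1, hz2, hz⟩ := zF k (e k) rfl
        have hk := hN k hNk
        have := hr k
        refine ⟨z, mem_ball.2 (by linarith), ?_, ?_⟩
        · rw [hfF k z (by linarith) (by linarith), hz, hek]
        · rintro rfl
          rw [dist_self] at hz1
          linarith
    · obtain ⟨k, hk⟩ := hcover x hx
      exact (gF k x).congr hk
  · by_cases hx : x = p
    · exact Or.inl (hx ▸ hfp)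
    · exact Or.inr (hfR x hx)
  · have huniq : ∀ z, f z = y → z = p := fun z hz =>
      by_contra fun h => hy (by simpa [hz] using hfR z h)
    rw [huniq x hx, huniq x' hx']

end Annuli

section Normed

variable {W E : Type*} [NormedAddCommGroup E] [NormedSpace ℝ E]

/-- Given closed `A₀` and a sequence of open sets `V s`, choose greedily in them pairwise
disjoint closed balls off `A₀`; the balls flagged by `pt` degenerate to points. -/
theorem exists_greedy_closedBalls [Nontrivial E] {A₀ : Set E} (hA₀ : IsClosed A₀) (V : ℕ → Set E)
    (hV : ∀ s, IsOpen (V s)) (pt : ℕ → Prop) :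
    ∃ (A : ℕ → Set E) (c : ℕ → E) (ρ : ℕ → ℝ), (∀ s, A₀ ⊆ A s) ∧
      (∀ s t, s < t → closedBall (c s) (ρ s) ⊆ A t) ∧
      (∀ s, closedBall (c s) (ρ s) ⊆ V s \ A s) ∧
      (∀ s, pt s → ρ s ≤ 0) ∧
      (∀ s, (V s \ A s).Nonempty → 0 ≤ ρ s ∧ (¬ pt s → 0 < ρ s)) ∧
      (∀ s, interior (A s) ⊆ interior A₀ ∪ ⋃ i, ball (c i) (ρ i)) := by
  have step : ∀ (s : ℕ) (A : Set E), ∃ b : E × ℝ, IsClosed A →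
      closedBall b.1 b.2 ⊆ V s \ A ∧ (pt s → b.2 ≤ 0) ∧
      ((V s \ A).Nonempty → 0 ≤ b.2 ∧ (¬ pt s → 0 < b.2)) := by
    intro s A
    by_cases hne : IsClosed A ∧ (V s \ A).Nonempty
    · obtain ⟨hA, x, hx⟩ := hne
      by_cases hp : pt s
      · refine ⟨(x, 0), fun _ => ⟨?_, fun _ => le_rfl, fun _ => ⟨le_rfl, fun h => absurd hp h⟩⟩⟩
        simpa using hx
      · obtain ⟨ε, hε, hsub⟩ := nhds_basis_closedBall.mem_iff.1
          (((hV s).sdiff hA).mem_nhds hx)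
        exact ⟨(x, ε), fun _ => ⟨hsub, fun h => absurd h hp, fun _ => ⟨hε.le, fun _ => hε⟩⟩⟩
    · refine ⟨(0, -1), fun hA => ⟨?_, fun _ => by norm_num, fun h => absurd ⟨hA, h⟩ hne⟩⟩
      rw [closedBall_eq_empty.2 (by norm_num)]
      exact empty_subset _
  choose b hb using step
  let A : ℕ → Set E := fun s =>
    Nat.rec A₀ (fun s A => A ∪ closedBall (b s A).1 (b s A).2) s
  have hsucc : ∀ s, A (s + 1) = A s ∪ closedBall (b s (A s)).1 (b s (A s)).2 := fun s => rfl
  have hclosed : ∀ s, IsClosed (A s) := by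
    intro s
    induction s with
    | zero => exact hA₀
    | succ s ih => rw [hsucc]; exact ih.union isClosed_closedBall
  have hmono : Monotone A :=
    monotone_nat_of_le_succ fun s => by rw [hsucc]; exact subset_union_left
  refine ⟨A, fun s => (b s (A s)).1, fun s => (b s (A s)).2, fun s => hmono (Nat.zero_le s),
    fun s t hst => ?_, fun s => (hb s _ (hclosed s)).1, fun s => (hb s _ (hclosed s)).2.1,
    fun s => (hb s _ (hclosed s)).2.2, fun s => ?_⟩
  · refine Subset.trans ?_ (hmono hst)
    change _ ⊆ A (s + 1)
    rw [hsucc]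
    exact subset_union_right
  · induction s with
    | zero => exact subset_union_left
    | succ s ih =>
      rw [hsucc]
      refine (interior_union_subset_of_disjoint (hclosed s) isClosed_closedBall ?_).trans ?_
      · rw [Set.disjoint_right]
        exact fun x hx => ((hb s _ (hclosed s)).1 hx).2
      · refine union_subset ih ?_
        rw [interior_closedBall']
        exact (subset_iUnion (fun i => ball (b i (A i)).1 (b i (A i)).2) s).trans
          subset_union_right

/-- Extension of `g₀` from the interior of a closed set `A₀` to the whole space: the complement of
`A₀` is filled with small balls carrying values above `a`, and with values in the cluster of the
reflexive point `a` off these balls. -/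
theorem exists_dMorph_extension [Nontrivial E] [SecondCountableTopology E] [Countable W]
    {R : W → W → Prop} (htrans : ∀ ⦃x y z⦄, R x y → R y z → R x z) {a : W} (ha : R a a)
    (hstrict : ∀ w, R a w → ¬ R w a → ∀ (c : E) (ρ : ℝ), 0 < ρ →
      ∃ g : E → W, (∀ x, DMorphAt R g x) ∧ (∀ x, g x = w ∨ R w (g x)) ∧ ∃ x ∈ ball c ρ, g x = w)
    {A₀ : Set E} (hA₀ : IsClosed A₀) {g₀ : E → W} (hg₀ : ∀ x ∈ interior A₀, DMorphAt R g₀ x)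
    (hfr : ∀ x ∈ frontier A₀, ∀ᶠ y in 𝓝 x, R a (g₀ y)) :
    ∃ f : E → W, (∀ x, DMorphAt R f x) ∧ (∀ x ∈ interior A₀, f x = g₀ x) ∧
      (∀ x ∉ interior A₀, R a (f x)) ∧ (∀ x ∈ frontier A₀, f x = a) ∧
      ∀ x ∈ frontier A₀, ∀ w, R a w → ∃ᶠ y in 𝓝[A₀ᶜ] x, f y = w := by
  classical
  have : Nonempty {w // R a w} := ⟨⟨a, ha⟩⟩
  have : Nonempty (TopologicalSpace.countableBasis E) := by
    obtain ⟨B, hB, -⟩ :=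
      (TopologicalSpace.isBasis_countableBasis E).mem_nhds_iff.1 (univ_mem (f := 𝓝 (0 : E)))
    exact ⟨⟨B, hB⟩⟩
  obtain ⟨e, he⟩ := exists_seq_visiting_infinitely_often
    ((TopologicalSpace.countableBasis E) × {w // R a w})
  let w : ℕ → W := fun s => (e s).2
  have hw : ∀ s, R a (w s) := fun s => (e s).2.2
  obtain ⟨A, c, ρ, hA, hDA, hDV, hpt, hne, hinter⟩ := exists_greedy_closedBalls hA₀
    (fun s => ((e s).1 : Set E))
    (fun s => TopologicalSpace.isOpen_of_mem_countableBasis (e s).1.2) (fun s => R (w s) a)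
  have hg : ∀ s, ∃ g : E → W, ¬ R (w s) a → 0 < ρ s → (∀ x, DMorphAt R g x) ∧
      (∀ x, g x = w s ∨ R (w s) (g x)) ∧ ∃ x ∈ ball (c s) (ρ s), g x = w s := by
    intro s
    by_cases h : ¬ R (w s) a ∧ 0 < ρ s
    · obtain ⟨g, hg⟩ := hstrict (w s) (hw s) h.1 (c s) (ρ s) h.2
      exact ⟨g, fun _ _ => hg⟩
    · exact ⟨fun _ => a, fun h₁ h₂ => absurd ⟨h₁, h₂⟩ h⟩
  choose g hg using hg
  let D : ℕ → Set E := fun s => closedBall (c s) (ρ s)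
  let h : ℕ → E → W := fun s x =>
    if R (w s) a then w s else if x ∈ ball (c s) (ρ s) then g s x else a
  have hDuniq : ∀ {s t x}, x ∈ D s → x ∈ D t → s = t := by
    intro s t x hs ht
    rcases lt_trichotomy s t with hst | hst | hst
    · exact absurd (hDA s t hst hs) (hDV t ht).2
    · exact hst
    · exact absurd (hDA t s hst ht) (hDV s hs).2
  have hDA₀ : ∀ {s x}, x ∈ D s → x ∉ A₀ := fun hs hx => (hDV _ hs).2 (hA _ hx)
  let f : E → W := fun x =>
    if x ∈ interior A₀ then g₀ x else if hx : ∃ s, x ∈ D s then h hx.choose x else a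
  have hf₀ : ∀ x ∈ interior A₀, f x = g₀ x := fun x hx => if_pos hx
  have hfD : ∀ {s x}, x ∈ D s → f x = h s x := by
    intro s x hx
    have hex : ∃ s, x ∈ D s := ⟨s, hx⟩
    have h1 : x ∉ interior A₀ := fun hi => hDA₀ hx (interior_subset hi)
    simp only [f, if_neg h1, dif_pos hex]
    rw [hDuniq hex.choose_spec hx]
  have hfK : ∀ x, x ∉ interior A₀ → (∀ s, x ∉ D s) → f x = a := by
    intro x hx hs
    simp only [f, if_neg hx]
    rw [dif_neg]
    simpa using hs
  have hpos : ∀ {s x}, x ∈ ball (c s) (ρ s) → 0 < ρ s ∧ ¬ R (w s) a := by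
    intro s x hx
    have h0 : 0 < ρ s := pos_of_mem_ball hx
    exact ⟨h0, fun hr => absurd (hpt s hr) (not_le.2 h0)⟩
  have hfball : ∀ {s x}, x ∈ ball (c s) (ρ s) → f x = g s x := by
    intro s x hx
    rw [hfD (ball_subset_closedBall hx)]
    simp only [h, if_neg (hpos hx).2, if_pos hx]
  have hfR : ∀ x ∉ interior A₀, R a (f x) := by
    intro x hx
    by_cases hs : ∃ s, x ∈ D s
    · obtain ⟨s, hs⟩ := hs
      rw [hfD hs]
      by_cases hr : R (w s) a
      · simpa only [h, if_pos hr] using hw s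
      · by_cases hb : x ∈ ball (c s) (ρ s)
        · simp only [h, if_neg hr, if_pos hb]
          rcases (hg s hr (hpos hb).1).2.1 x with hx | hx
          · rw [hx]; exact hw s
          · exact htrans (hw s) hx
        · simpa only [h, if_neg hr, if_neg hb] using ha
    · rw [hfK x hx (by simpa using hs)]
      exact ha
  have hfC : ∀ x ∉ interior A₀, (∀ s, x ∉ ball (c s) (ρ s)) → R (f x) a := by
    intro x hx hb
    by_cases hs : ∃ s, x ∈ D s
    · obtain ⟨s, hs⟩ := hs
      rw [hfD hs]
      by_cases hr : R (w s) a
      · simpa only [h, if_pos hr] using hr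
      · simpa only [h, if_neg hr, if_neg (hb s)] using ha
    · rw [hfK x hx (by simpa using hs)]
      exact ha
  have key : ∀ x ∉ interior A₀, (∀ s, x ∉ ball (c s) (ρ s)) → ∀ v, R a v →
      ∃ᶠ y in 𝓝 x, y ∉ A₀ ∧ y ≠ x ∧ f y = v := by
    intro x hx hb v hv
    rw [frequently_iff]
    intro U hU
    obtain ⟨B, hB, hxB, hBU⟩ :=
      (TopologicalSpace.isBasis_countableBasis E).mem_nhds_iff.1 hU
    have hnot : ∀ s, ((e s).1 : Set E) = B → (((e s).1 : Set E) \ A s).Nonempty := by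
      intro s hs
      rw [hs]
      by_contra hemp
      rw [not_nonempty_iff_eq_empty, sdiff_eq_empty] at hemp
      have hxi : x ∈ interior (A s) := interior_mono hemp
        (by rwa [(TopologicalSpace.isOpen_of_mem_countableBasis hB).interior_eq])
      rcases hinter s hxi with h1 | h1
      · exact hx h1
      · obtain ⟨i, hi⟩ := mem_iUnion.1 h1
        exact hb i hi
    obtain ⟨s, hes, hxs⟩ : ∃ s, e s = (⟨B, hB⟩, ⟨v, hv⟩) ∧ x ∉ D s := by
      by_cases hs : ∃ t, x ∈ D t
      · obtain ⟨t, ht⟩ := hs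
        obtain ⟨s, hs, hes⟩ := he (⟨B, hB⟩, ⟨v, hv⟩) (t + 1)
        refine ⟨s, hes, fun hxs => ?_⟩
        have := hDuniq ht hxs
        omega
      · obtain ⟨s, -, hes⟩ := he (⟨B, hB⟩, ⟨v, hv⟩) 0
        exact ⟨s, hes, fun hxs => hs ⟨s, hxs⟩⟩
    have heB : ((e s).1 : Set E) = B := by rw [hes]
    have hwv : w s = v := by simp only [w, hes]
    obtain ⟨h0, h0'⟩ := hne s (hnot s heB)
    have hDU : ∀ y ∈ D s, y ∈ U := fun y hy => hBU (heB ▸ (hDV s hy).1)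
    obtain ⟨y, hy, hfy⟩ : ∃ y ∈ D s, f y = v := by
      by_cases hr : R (w s) a
      · have hc : c s ∈ D s := mem_closedBall_self h0
        refine ⟨c s, hc, ?_⟩
        rw [hfD hc, ← hwv]
        simp only [h, if_pos hr]
      · obtain ⟨y, hy, hgy⟩ := (hg s hr (h0' hr)).2.2
        exact ⟨y, ball_subset_closedBall hy, by rw [hfball hy, hgy, hwv]⟩
    exact ⟨y, hDU y hy, hDA₀ hy, fun hyx => hxs (hyx ▸ hy), hfy⟩
  have hfrb : ∀ x ∈ frontier A₀, x ∉ interior A₀ ∧ ∀ s, x ∉ D s := by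
    intro x hx
    rw [hA₀.frontier_eq] at hx
    exact ⟨hx.2, fun s hs => hDA₀ hs hx.1⟩
  refine ⟨f, fun x => ?_, hf₀, hfR, fun x hx => hfK x (hfrb x hx).1 (hfrb x hx).2,
    fun x hx v hv => ?_⟩
  · by_cases hx : x ∈ interior A₀
    · exact (hg₀ x hx).congr_of_isOpen isOpen_interior hx hf₀
    by_cases hb : ∃ s, x ∈ ball (c s) (ρ s)
    · obtain ⟨s, hs⟩ := hb
      exact ((hg s (hpos hs).2 (hpos hs).1).1 x).congr_of_isOpen isOpen_ball hs
        fun y hy => hfball hy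
    push Not at hb
    refine ⟨?_, fun v hv => ?_⟩
    · have : ∀ᶠ y in 𝓝 x, R a (f y) := by
        have h1 : ∀ᶠ y in 𝓝 x, y ∈ interior A₀ → R a (g₀ y) := by
          by_cases hxA : x ∈ A₀
          · have := hfr x (by rw [hA₀.frontier_eq]; exact ⟨hxA, hx⟩)
            filter_upwards [this] with y hy _ using hy
          · filter_upwards [hA₀.isOpen_compl.mem_nhds hxA] with y hy hyi
            exact absurd (interior_subset hyi) hy
        filter_upwards [h1] with y hy
        by_cases hyi : y ∈ interior A₀
        · rw [hf₀ y hyi]; exact hy hyi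
        · exact hfR y hyi
      filter_upwards [this.filter_mono nhdsWithin_le_nhds] with y hy
      exact htrans (hfC x hx hb) hy
    · rw [frequently_nhdsWithin_iff]
      refine (key x hx hb v (htrans (hfR x hx) hv)).mono ?_
      rintro y ⟨-, hyx, hfy⟩
      exact ⟨hfy, hyx⟩
  · rw [frequently_nhdsWithin_iff]
    refine (key x (hfrb x hx).1 (fun s hs => (hfrb x hx).2 s (ball_subset_closedBall hs)) v
      hv).mono ?_
    rintro y ⟨hyA, -, hfy⟩
    exact ⟨hfy, hyA⟩
theorem exists_dist_eq_of_nonneg [Nontrivial E] (p : E) {t : ℝ} (ht : 0 ≤ t) : ∃ q, dist q p = t := by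
  obtain ⟨q, hq⟩ := (NormedSpace.sphere_nonempty (x := p) (r := t)).2 ht
  exact ⟨q, hq⟩

theorem HasInsertion.hasTransition [Nontrivial E] {R : W → W → Prop} {base : W → E → W} {y m : W}
    (h : HasInsertion R base y m) {V : Set W} (hy : y ∈ V) (hV : ∀ w, R y w → w ∈ V) :
    HasTransition R base V m m {y} := by
  intro p s r hs hsr
  obtain ⟨q, hq⟩ := exists_dist_eq_of_nonneg p (t := (s + r) / 2) (by linarith)
  obtain ⟨f, g, v, o, ⟨x, hx, hfx⟩, -⟩ := h q ((r - s) / 2) (by linarith)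
  refine ⟨f, g, fun x => ?_, fun x hx => o x ?_, fun x hx => o x ?_, ?_⟩
  · rcases v x with h | h
    · rw [h]; exact hy
    · exact hV _ h
  · linarith [dist_triangle x q p]
  · linarith [dist_triangle q x p, dist_comm x q]
  · rintro w rfl
    rw [mem_ball] at hx
    exact ⟨x, by linarith [dist_triangle q x p, dist_comm x q], by linarith [dist_triangle x q p],
      hfx⟩

/-- Realisation of `y` in the case that it is reflexive. -/
theorem hasInsertion_of_refl [Nontrivial E] [SecondCountableTopology E] [Countable W]
    {R : W → W → Prop} (htrans : ∀ ⦃x y z⦄, R x y → R y z → R x z) {base : W → E → W} {y m : W}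
    (hy : R y y) (hstrict : ∀ w, R y w → ¬ R w y → ∃ m, HasInsertion R base w m)
    (hym : R y m) (hm : ∀ x, DMorphAt R (base m) x ∧ R m (base m x)) :
    HasInsertion R base y m := by
  intro p ρ hρ
  have hcl : IsClosed (ball p (ρ / 2))ᶜ := isOpen_ball.isClosed_compl
  obtain ⟨f, g, hinter, hv, -, hfreq⟩ := exists_dMorph_extension htrans hy
    (fun w hw hw' c ρ hρ => by
      obtain ⟨m, h⟩ := hstrict w hw hw'
      obtain ⟨f, h1, h2, -, h3, -⟩ := h c ρ hρ
      exact ⟨f, h1, h2, h3⟩) hcl (fun x _ => (hm x).1)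
    (fun x _ => Eventually.of_forall fun x => htrans hym (hm x).2)
  refine ⟨f, g, fun x => ?_, fun x hx => hinter x ?_, ?_, fun h => absurd hy h⟩
  · by_cases hx : x ∈ interior (ball p (ρ / 2))ᶜ
    · rw [hinter x hx]; exact Or.inr (htrans hym (hm x).2)
    · exact Or.inr (hv x hx)
  · refine interior_maximal (t := {x | ρ / 2 < dist x p}) (fun z hz => ?_)
      (isOpen_setOf_lt_dist p _) (show ρ / 2 < dist x p by linarith)
    simpa using (show ρ / 2 < dist z p from hz).le
  · obtain ⟨q, hq⟩ := exists_dist_eq_of_nonneg p hρ.le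
    obtain ⟨z, hz⟩ : (frontier (ball p (ρ / 2))ᶜ).Nonempty := by
      rw [nonempty_frontier_iff]
      refine ⟨⟨q, ?_⟩, fun h => ?_⟩
      · simp only [mem_compl_iff, mem_ball, hq]; linarith
      · have : p ∈ (ball p (ρ / 2))ᶜ := h ▸ mem_univ p
        exact this (mem_ball_self (by linarith))
    obtain ⟨x, hx, hx'⟩ := ((hfreq z hz y hy).and_eventually self_mem_nhdsWithin).exists
    exact ⟨x, ball_subset_ball (by linarith) (not_notMem.1 hx'), hx⟩

/-- A reflexive `y` lies below all changes of background between its successors. -/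
theorem hasTransition_of_refl [Nontrivial E] [SecondCountableTopology E] [Countable W]
    {R : W → W → Prop} (htrans : ∀ ⦃x y z⦄, R x y → R y z → R x z) {base : W → E → W} {y m m' : W}
    (hy : R y y) (hstrict : ∀ w, R y w → ¬ R w y → ∃ m, HasInsertion R base w m)
    (hym : R y m) (hm : ∀ x, DMorphAt R (base m) x ∧ R m (base m x))
    (hym' : R y m') (hm' : ∀ x, DMorphAt R (base m') x ∧ R m' (base m' x)) :
    HasTransition R base {w | R y w} m m' ∅ := by
  classical
  intro p s r hs hsr
  obtain ⟨t, hst, htr⟩ := exists_between hsr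
  obtain ⟨s', hss', hs't⟩ := exists_between hst
  obtain ⟨r', htr', hr'r⟩ := exists_between htr
  let g₀ : E → W := fun x => if dist x p < t then base m' x else base m x
  have ho : ∀ x, t < dist x p → g₀ x = base m x := fun x hx => if_neg (not_lt.2 hx.le)
  have hi : ∀ x, dist x p < t → g₀ x = base m' x := fun x hx => if_pos hx
  have hg₀ : ∀ x, R y (g₀ x) := by
    intro x
    by_cases hx : dist x p < t
    · rw [hi x hx]; exact htrans hym' (hm' x).2
    · simp only [g₀, if_neg hx]; exact htrans hym (hm x).2
  let A : Set E := {x | r' ≤ dist x p} ∪ {x | dist x p ≤ s'}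
  have hA : IsClosed A := (isClosed_le continuous_const (by fun_prop)).union
    (isClosed_le (by fun_prop) continuous_const)
  obtain ⟨f, g, hinter, hv, -, -⟩ := exists_dMorph_extension htrans hy
    (fun w hw hw' c ρ hρ => by
      obtain ⟨m, h⟩ := hstrict w hw hw'
      obtain ⟨f, h1, h2, -, h3, -⟩ := h c ρ hρ
      exact ⟨f, h1, h2, h3⟩) hA (g₀ := g₀)
    (fun x hx => by
      rcases interior_subset hx with hx | hx
      · exact (hm x).1.congr_of_isOpen (isOpen_setOf_lt_dist p t)
          (htr'.trans_le hx) ho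
      · exact (hm' x).1.congr_of_isOpen (isOpen_setOf_dist_lt p t)
          (lt_of_le_of_lt hx hs't) hi)
    (fun x _ => Eventually.of_forall hg₀)
  refine ⟨f, g, fun x => ?_, fun x hx => ?_, fun x hx => ?_, by simp⟩
  · by_cases hx : x ∈ interior A
    · rw [hinter x hx]; exact hg₀ x
    · exact hv x hx
  · rw [hinter x, ho x (by linarith)]
    exact interior_maximal (t := {x | r' < dist x p}) (fun z (hz : r' < dist z p) => Or.inl hz.le)
      (isOpen_setOf_lt_dist p r') (show r' < dist x p by linarith)
  · rw [hinter x, hi x (by linarith)]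
    exact interior_maximal (t := {x | dist x p < s'}) (fun z (hz : dist z p < s') => Or.inr hz.le)
      (isOpen_setOf_dist_lt p s') (show dist x p < s' by linarith)

theorem exists_base [Nontrivial E] [SecondCountableTopology E] [Countable W] {R : W → W → Prop}
    (htrans : ∀ ⦃x y z⦄, R x y → R y z → R x z) (hserial : ∀ x, ∃ y, R x y) {m : W}
    (hm : ∀ z, R m z → R z m) :
    ∃ b : E → W, ∀ x, DMorphAt R b x ∧ R m (b x) := by
  obtain ⟨z, hz⟩ := hserial m
  obtain ⟨f, g, -, hv, -⟩ := exists_dMorph_extension (E := E) htrans (htrans hz (hm z hz))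
    (fun w hw hw' => absurd (hm w hw) hw') isClosed_empty (g₀ := fun _ => m) (by simp) (by simp)
  exact ⟨f, fun x => ⟨g x, hv x (by simp)⟩⟩

theorem hasInsertion_and_hasTransition [Nontrivial E] [SecondCountableTopology E] [Finite W]
    {R RD : W → W → Prop} (hF : IsDT1CKFrame R RD) {base : W → E → W}
    (hbase : ∀ m, (∀ z, R m z → R z m) → ∀ x, DMorphAt R (base m) x ∧ R m (base m x)) (y : W) :
    (∀ m, R y m → (∀ z, R m z → R z m) → HasInsertion R base y m) ∧
    ∀ m m', R y m → (∀ z, R m z → R z m) → R y m' → (∀ z, R m' z → R z m') →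
      HasTransition R base {v | R y v} m m' ∅ := by
  induction y using (wellFounded_strictSuccessor hF.trans).induction with
  | _ y ih =>
  by_cases hy : R y y
  · have hstrict : ∀ w, R y w → ¬ R w y → ∃ m, HasInsertion R base w m := by
      intro w hw hw'
      obtain ⟨m, hwm, hm⟩ := exists_maximal_successor hF.trans hF.serial w
      exact ⟨m, (ih w ⟨hw, hw'⟩).1 m hwm hm⟩
    exact ⟨fun m hym hm => hasInsertion_of_refl hF.trans hy hstrict hym (hbase m hm),
      fun m m' hym hm hym' hm' =>
        hasTransition_of_refl hF.trans hy hstrict hym (hbase m hm) hym' (hbase m' hm')⟩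
  · have ih' : ∀ w, R y w → _ := fun w hw => ih w ⟨hw, fun h => hy (hF.trans hw h)⟩
    have htr : ∀ m m', R y m → (∀ z, R m z → R z m) → R y m' → (∀ z, R m' z → R z m') →
        HasTransition R base {v | R y v} m m' ∅ := fun m m' hym hm hym' hm' =>
      hasTransition_of_irrefl hF hy (fun w hw => (ih' w hw).2) hym hm hym' hm'
    refine ⟨fun m hym hm => hasInsertion_of_irrefl hF.serial hy fun w hw => ?_, htr⟩
    obtain ⟨k, hwk, hk⟩ := exists_maximal_successor hF.trans hF.serial w
    have hyk := hF.trans hw hwk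
    have := ((htr m k hym hm hyk hk).comp (((ih' w hw).1 k hwk hk).hasTransition hw
      fun v hv => hF.trans hw hv)).comp (htr k m hyk hk hym hm)
    rwa [empty_union, union_empty] at this

/-- An insertion of `y` can be carried out twice in the same ball. -/
theorem HasInsertion.exists_two [Nontrivial E] {R : W → W → Prop} {base : W → E → W} {y m : W}
    (h : HasInsertion R base y m) (p : E) {ρ : ℝ} (hρ : 0 < ρ) :
    ∃ f : E → W, (∀ x, DMorphAt R f x) ∧ (∀ x, ρ ≤ dist x p → f x = base m x) ∧
      ∃ x x', x ≠ x' ∧ x ∈ ball p ρ ∧ x' ∈ ball p ρ ∧ f x = y ∧ f x' = y := by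
  obtain ⟨q, hq⟩ := exists_dist_eq_of_nonneg p (t := 3 / 4 * ρ) (by linarith)
  obtain ⟨f₁, g₁, -, o₁, ⟨x₁, hx₁, hf₁⟩, -⟩ := h q (ρ / 4) (by linarith)
  obtain ⟨f₂, g₂, -, o₂, ⟨x₂, hx₂, hf₂⟩, -⟩ := h p (ρ / 4) (by linarith)
  rw [mem_ball] at hx₁ hx₂
  obtain ⟨f, g, hF₁, hF₂⟩ := exists_dMorph_glue g₁ g₂ (p := p) (t₁ := ρ / 4) (t₂ := ρ / 2)
    (by linarith) (fun x hx hx' => by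
      rw [o₂ x hx.le, o₁ x (by linarith [dist_triangle q x p, dist_comm x q])])
  have hx₁' : ρ / 2 < dist x₁ p := by linarith [dist_triangle q x₁ p, dist_comm x₁ q]
  refine ⟨f, g, fun x hx => ?_, x₁, x₂, fun he => ?_, ?_, ?_, ?_, ?_⟩
  · rw [hF₁ x (by linarith), o₁ x (by linarith [dist_triangle x q p])]
  · subst he; linarith
  · rw [mem_ball]; linarith [dist_triangle x₁ q p]
  · rw [mem_ball]; linarith
  · rw [hF₁ x₁ (by linarith), hf₁]
  · rw [hF₂ x₂ (by linarith), hf₂]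

/-- The global form of the construction: a map on the whole space which is a d-morphism at every
point and has the prescribed value on a sphere, every point of which sees all the required values
from inside. -/
theorem exists_dMorph_const_on_sphere [Nontrivial E] [SecondCountableTopology E] [Finite W]
    {R RD : W → W → Prop} (hF : IsDT1CKFrame R RD) {o : W} (ho : ∀ w, w = o ∨ R o w) {w' : W}
    (hw' : R w' w') {r : ℝ} (hr : 0 < r) :
    ∃ f : E → W, (∀ x, DMorphAt R f x) ∧ (∃ x ∈ ball 0 r, f x = o) ∧
      (RD o o → ∃ x x', x ≠ x' ∧ x ∈ ball 0 r ∧ x' ∈ ball 0 r ∧ f x = o ∧ f x' = o) ∧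
      (¬ RD o o → ∀ x x', f x = o → f x' = o → x = x') ∧
      ∀ x ∈ sphere 0 r, f x = w' ∧ ∀ w, R w' w → ∃ᶠ y in 𝓝[closedBall 0 r] x, y ≠ x ∧ f y = w := by
  have hb : ∀ m, ∃ b : E → W, (∀ z, R m z → R z m) → ∀ x, DMorphAt R b x ∧ R m (b x) := by
    intro m
    by_cases hm : ∀ z, R m z → R z m
    · obtain ⟨b, hb⟩ := exists_base (E := E) hF.trans hF.serial hm
      exact ⟨b, fun _ => hb⟩
    · exact ⟨fun _ => m, fun h => absurd h hm⟩
  choose base hbase using hb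
  have hins := fun y => (hasInsertion_and_hasTransition hF hbase y).1
  obtain ⟨m, hw'm, hm⟩ := exists_maximal_successor hF.trans hF.serial w'
  have hom : R o m := by
    rcases ho w' with rfl | h
    · exact hw'm
    · exact hF.trans h hw'm
  obtain ⟨g₀, hg₀, hout, hone, htwo, huniq⟩ : ∃ g₀ : E → W, (∀ x, DMorphAt R g₀ x) ∧
      (∀ x, r / 4 ≤ dist x 0 → g₀ x = base m x) ∧ (∃ x ∈ ball 0 (r / 4), g₀ x = o) ∧
      (RD o o → ∃ x x', x ≠ x' ∧ x ∈ ball 0 (r / 4) ∧ x' ∈ ball 0 (r / 4) ∧ g₀ x = o ∧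
        g₀ x' = o) ∧ (¬ RD o o → ∀ x x', g₀ x = o → g₀ x' = o → x = x') := by
    have h := hins o m hom hm
    by_cases hoo : RD o o
    · obtain ⟨f, g, hf, x, x', h1, h2, h3, h4, h5⟩ := h.exists_two 0 (by linarith : 0 < r / 4)
      exact ⟨f, g, hf, ⟨x, h2, h4⟩, fun _ => ⟨x, x', h1, h2, h3, h4, h5⟩, fun h => absurd hoo h⟩
    · obtain ⟨f, g, -, hf, hx, hu⟩ := h 0 (r / 4) (by linarith)
      exact ⟨f, g, hf, hx, fun h => absurd h hoo, fun _ => hu fun h => hoo (hF.sub o o h)⟩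
  let A : Set E := {x | r ≤ dist x 0} ∪ {x | dist x 0 ≤ r / 2}
  have hA : IsClosed A := (isClosed_le continuous_const (by fun_prop)).union
    (isClosed_le (by fun_prop) continuous_const)
  have hball : ball 0 (r / 2) ⊆ interior A :=
    interior_maximal (fun x hx => Or.inr (mem_ball.1 hx).le) isOpen_ball
  have hext : ball 0 (r / 4) ⊆ interior A := (ball_subset_ball (by linarith)).trans hball
  have hAc : Aᶜ ⊆ closedBall 0 r := fun x hx =>
    mem_closedBall.2 (not_le.1 fun h => hx (Or.inl h)).le
  obtain ⟨f, g, hinter, hv, hfr, hfreq⟩ := exists_dMorph_extension hF.trans hw'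
    (fun w _ _ c ρ hρ => by
      obtain ⟨k, hwk, hk⟩ := exists_maximal_successor hF.trans hF.serial w
      obtain ⟨f, h1, h2, -, h3, -⟩ := hins w k hwk hk c ρ hρ
      exact ⟨f, h1, h2, h3⟩) hA (fun x _ => hg₀ x)
    (fun x hx => by
      have hx' : r / 4 < dist x 0 := by
        by_contra hcon
        rw [hA.frontier_eq] at hx
        exact hx.2 (hball (mem_ball.2 (by linarith)))
      filter_upwards [(isOpen_setOf_lt_dist 0 _).mem_nhds hx'] with z hz
      rw [hout z (le_of_lt hz)]
      exact hF.trans hw'm (hbase m hm z).2)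
  have hsphere : sphere 0 r ⊆ frontier A := by
    intro x hx
    rw [mem_sphere] at hx
    have hxA : x ∈ A := Or.inl hx.ge
    rw [hA.frontier_eq]
    refine ⟨hxA, fun hxi => ?_⟩
    have hcl : x ∈ closure (ball (0 : E) r) := by
      rw [closure_ball _ hr.ne']
      exact mem_closedBall.2 hx.le
    have hO : {z : E | r / 2 < dist z 0} ∩ interior A ∈ 𝓝 x :=
      inter_mem ((isOpen_setOf_lt_dist 0 _).mem_nhds (show r / 2 < dist x 0 by linarith))
        (isOpen_interior.mem_nhds hxi)
    obtain ⟨z, ⟨hz1, hz2⟩, hz3⟩ := mem_closure_iff_nhds.1 hcl _ hO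
    rcases interior_subset hz2 with h | h
    · exact absurd (mem_ball.1 hz3) (not_lt.2 h)
    · exact absurd (show r / 2 < dist z 0 from hz1) (not_lt.2 h)
  refine ⟨f, g, ?_, fun hoo => ?_, fun hoo => ?_, fun x hx => ⟨hfr x (hsphere hx), fun w hw => ?_⟩⟩
  · obtain ⟨x, hx, hxo⟩ := hone
    exact ⟨x, ball_subset_ball (by linarith) hx, by rw [hinter x (hext hx), hxo]⟩
  · obtain ⟨x, x', h1, h2, h3, h4, h5⟩ := htwo hoo
    exact ⟨x, x', h1, ball_subset_ball (by linarith) h2, ball_subset_ball (by linarith) h3,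
      by rw [hinter x (hext h2), h4], by rw [hinter x' (hext h3), h5]⟩
  · have hmem : ∀ x, f x = o → g₀ x = o := by
      intro x hx
      by_cases hxi : x ∈ interior A
      · rwa [← hinter x hxi]
      · exact absurd (hx ▸ hv x hxi) (hF.irrefl_min o hoo w')
    exact fun x x' hx hx' => huniq hoo x x' (hmem x hx) (hmem x' hx')
  · refine (((hfreq x (hsphere hx) w hw).and_eventually self_mem_nhdsWithin).mono ?_).filter_mono
      (nhdsWithin_mono x hAc)
    rintro y ⟨hy, hyA⟩
    refine ⟨?_, hy⟩
    rintro rfl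
    exact hyA (Or.inl (mem_sphere.1 hx).ge)

end Normed

/-- for `n ≥ 2`, the closed ball of radius `r > 0` in `ℝⁿ` admits
a dd-morphism onto any finite rooted DT1CK-frame, sending the boundary sphere
to a prescribed `R`-reflexive point `w'`. -/
theorem ddMorphism_from_closed_ball_onto_DT1CK_frame
    (n : ℕ) (hn : 2 ≤ n) (r : ℝ) (hr : 0 < r)
    {W : Type*} [Finite W] [Nonempty W] (R RD : W → W → Prop)
    (hF : IsDT1CKFrame R RD) (w' : W) (hw' : R w' w') :
    ∃ f : (Metric.closedBall (0 : EuclideanSpace ℝ (Fin n)) r) → W,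
      Function.Surjective f ∧
      (∀ w, derivedSet (f ⁻¹' {w}) = f ⁻¹' {v | R v w}) ∧
      (∀ x y, x ≠ y → RD (f x) (f y)) ∧
      (∀ x w, RD (f x) w → ∃ y, y ≠ x ∧ f y = w) ∧
      (∀ x : Metric.closedBall (0 : EuclideanSpace ℝ (Fin n)) r,
        ‖(x : EuclideanSpace ℝ (Fin n))‖ = r → f x = w') := by
  have : Nontrivial (EuclideanSpace ℝ (Fin n)) := by
    have : Nonempty (Fin n) := ⟨⟨0, by omega⟩⟩
    infer_instance
  obtain ⟨o, ho⟩ := hF.rooted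
  obtain ⟨f, hf, ⟨x₀, hx₀, hfx₀⟩, htwo, huniq, hsph⟩ :=
    exists_dMorph_const_on_sphere (E := EuclideanSpace ℝ (Fin n)) hF ho hw' hr
  have hnear : ∀ w, R o w → ∀ x, ∃ y ∈ closedBall 0 r, y ≠ x ∧ f y = w := by
    intro w hw x
    have h1 : ∀ᶠ y in 𝓝[≠] x₀, y ≠ x := by
      by_cases hx : x = x₀
      · subst hx; exact self_mem_nhdsWithin
      · exact mem_nhdsWithin_of_mem_nhds (isOpen_ne.mem_nhds (Ne.symm hx))
    have h2 : ∀ᶠ y in 𝓝[≠] x₀, y ∈ ball 0 r :=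
      mem_nhdsWithin_of_mem_nhds (isOpen_ball.mem_nhds hx₀)
    obtain ⟨y, hy, hyx, hyb⟩ := (((hf x₀).2 w (hfx₀ ▸ hw)).and_eventually (h1.and h2)).exists
    exact ⟨y, ball_subset_closedBall hyb, hyx, hy⟩
  have hsurj : ∀ w, ∃ y ∈ closedBall 0 r, f y = w := by
    intro w
    rcases ho w with rfl | h
    · exact ⟨x₀, ball_subset_closedBall hx₀, hfx₀⟩
    · obtain ⟨y, hy, -, hfy⟩ := hnear w h x₀
      exact ⟨y, hy, hfy⟩
  refine ⟨fun x => f x, fun w => ?_, fun w => ?_, fun x y hxy => ?_, fun x w hxw => ?_,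
    fun x hx => (hsph x (by simpa using hx)).1⟩
  · obtain ⟨y, hy, hfy⟩ := hsurj w
    exact ⟨⟨y, hy⟩, hfy⟩
  · ext x
    have hiff : x ∈ derivedSet ((fun x : closedBall (0 : EuclideanSpace ℝ (Fin n)) r => f x) ⁻¹' {w})
        ↔ ∃ᶠ y : EuclideanSpace ℝ (Fin n) in 𝓝[closedBall 0 r] x, y ≠ x ∧ f y = w := by
      rw [mem_derivedSet, accPt_iff_frequently, ← frequently_nhds_subtype_iff]
      simp [Subtype.ext_iff]
    rw [hiff]
    change _ ↔ R (f x) w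
    refine ⟨fun h => ?_, fun h => ?_⟩
    · have h1 := eventually_nhdsWithin_iff.1 (hf x).1
      obtain ⟨y, ⟨hyx, hfy⟩, hy⟩ :=
        (h.and_eventually (h1.filter_mono nhdsWithin_le_nhds)).exists
      exact hfy ▸ hy hyx
    · rcases (mem_closedBall.1 x.2).lt_or_eq with hx | hx
      · rw [nhdsWithin_eq_nhds.2 (mem_of_superset (isOpen_ball.mem_nhds (mem_ball.2 hx))
          ball_subset_closedBall)]
        refine (frequently_nhdsWithin_iff.1 ((hf x).2 w h)).mono ?_
        rintro y ⟨hy, hyx⟩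
        exact ⟨hyx, hy⟩
      · obtain ⟨hfx, hw⟩ := hsph x hx
        exact hw w (hfx ▸ h)
  · by_cases hne : f x = f y
    · by_contra hcon
      change ¬ RD (f x) (f y) at hcon
      rw [← hne] at hcon
      have hxo : f x = o := (ho (f x)).resolve_right (hF.irrefl_min _ hcon o)
      rw [hxo] at hcon
      exact hxy (Subtype.ext (huniq hcon x y hxo (hne ▸ hxo)))
    · exact hF.diff _ _ hne
  · by_cases hne : f x = w
    · rcases ho w with rfl | h
      · obtain ⟨y, y', hyy', hy, hy', hfy, hfy'⟩ := htwo (hne ▸ hxw)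
        by_cases hyx : y = x
        · exact ⟨⟨y', ball_subset_closedBall hy'⟩,
            fun h => hyy' (hyx.trans (congrArg Subtype.val h).symm), hfy'⟩
        · exact ⟨⟨y, ball_subset_closedBall hy⟩, fun h => hyx (congrArg Subtype.val h), hfy⟩
      · obtain ⟨y, hy, hyx, hfy⟩ := hnear w h x
        exact ⟨⟨y, hy⟩, fun h => hyx (congrArg Subtype.val h), hfy⟩
    · obtain ⟨y, hy, hfy⟩ := hsurj w
      exact ⟨⟨y, hy⟩, fun h => hne (by rw [← hfy, ← h]), hfy⟩
end

section
/- Let n ≥ 2, 0 ≤ r₁ < r₂, and let X = {x ∈ ℝⁿ : r₁ ≤ ‖x‖ ≤ r₂} with the subspace topology, Y' = {x : ‖x‖ = r₁}, Y'' = {x : ‖x‖ = r₂}. Let F = (W,R,R_D) be a finite rooted DT1CK-frame and w', w'' ∈ W with w' R w' and w'' R w''. Then there exists a surjective f : X → W such that: (i) d_X(f⁻¹(w)) = f⁻¹(R⁻¹(w)) for every w ∈ W, where d_X is the derived-set operation of the subspace X; (ii) f(x) R_D f(y) whenever x ≠ y in X; (iii) whenever f(x) R_D w there exists y ∈ X with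 y ≠ x and f(y) = w; and (iv) f(Y') = {w'} and f(Y'') = {w''}. -/
open Set Filter Topology Metric TopologicalSpace

namespace ShellMorphism

section LocalConditions

variable {E W : Type*} [TopologicalSpace E] {R : W → W → Prop} {f g : E → W} {A B : Set E} {x : E}

/-- Near `x`, the points of `A` other than `x` have values `R`-above the value at `x`. -/
def Forth (R : W → W → Prop) (f : E → W) (A : Set E) (x : E) : Prop :=
  ∀ᶠ y in 𝓝[A] x, y ≠ x → R (f x) (f y)

/-- Every value `R`-above the value at `x` is taken in `A` arbitrarily close to `x`. -/
def Back (R : W → W → Prop) (f : E → W) (A : Set E) (x : E) : Prop :=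
  ∀ w, R (f x) w → ∃ᶠ y in 𝓝[A] x, y ≠ x ∧ f y = w

/-- `f` restricted to `A` is a morphism from the derived-set structure of `A` to `(W, R)`. -/
def IsDMapOn (R : W → W → Prop) (f : E → W) (A : Set E) : Prop :=
  ∀ x ∈ A, Forth R f A x ∧ Back R f A x

theorem Forth.mono (h : Forth R f B x) (hAB : A ⊆ B) : Forth R f A x :=
  h.filter_mono (nhdsWithin_mono _ hAB)

theorem Back.mono (h : Back R f A x) (hAB : A ⊆ B) : Back R f B x :=
  fun w hw => (h w hw).filter_mono (nhdsWithin_mono _ hAB)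

theorem Forth.congr (h : Forth R f A x) (hx : f x = g x) (e : EqOn f g A) : Forth R g A x := by
  filter_upwards [h, self_mem_nhdsWithin] with y hy hyA hne
  rw [← hx, ← e hyA]
  exact hy hne

theorem Back.congr (h : Back R f A x) (hx : f x = g x) (e : EqOn f g A) : Back R g A x := by
  intro w hw
  rw [← hx] at hw
  refine ((h w hw).and_eventually self_mem_nhdsWithin).mono ?_
  rintro y ⟨⟨hne, hy⟩, hyA⟩
  exact ⟨hne, by rw [← e hyA, hy]⟩

theorem Forth.of_notMem (hA : IsClosed A) (hx : x ∉ A) : Forth R f A x := by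
  rw [← hA.closure_eq, notMem_closure_iff_nhdsWithin_eq_bot] at hx
  simp [Forth, hx]

theorem Forth.union (h₁ : Forth R f A x) (h₂ : Forth R f B x) : Forth R f (A ∪ B) x := by
  rw [Forth, nhdsWithin_union]
  exact eventually_sup.2 ⟨h₁, h₂⟩

/-- Two morphisms on closed sets glue when, on the overlap, they agree or the values of the
first one lie below all values of the second one. -/
theorem IsDMapOn.glue [∀ y, Decidable (y ∈ A)] (hA : IsClosed A) (hB : IsClosed B)
    (hf : IsDMapOn R f A) (hg : IsDMapOn R g B)
    (hAB : ∀ x ∈ A ∩ B, f x = g x ∨ ∀ y ∈ B, R (f x) (g y)) :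
    IsDMapOn R (A.piecewise f g) (A ∪ B) := by
  have eA : EqOn f (A.piecewise f g) A := fun y hy => (piecewise_eq_of_mem A f g hy).symm
  have eB : EqOn g (A.piecewise f g) (B \ A) := fun y hy =>
    (piecewise_eq_of_notMem A f g hy.2).symm
  intro x hx
  by_cases hxA : x ∈ A
  · have hFA : Forth R (A.piecewise f g) A x := (hf x hxA).1.congr (eA hxA) eA
    refine ⟨hFA.union ?_, ((hf x hxA).2.congr (eA hxA) eA).mono subset_union_left⟩
    by_cases hxB : x ∈ B
    · have hFA' := eventually_nhdsWithin_iff.1 hFA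
      have hgB : ∀ᶠ y in 𝓝[B] x, y ≠ x → R (f x) (g y) := by
        rcases hAB x ⟨hxA, hxB⟩ with h | h
        · rw [h]; exact (hg x hxB).1
        · filter_upwards [self_mem_nhdsWithin] with y hy _
          exact h y hy
      filter_upwards [hgB, nhdsWithin_le_nhds hFA', self_mem_nhdsWithin] with y h₁ h₂ hyB hne
      by_cases hyA : y ∈ A
      · exact h₂ hyA hne
      · rw [← eA hxA, ← eB ⟨hyB, hyA⟩]
        exact h₁ hne
    · exact Forth.of_notMem hB hxB
  · have hxB : x ∈ B := hx.resolve_left hxA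
    have hev : 𝓝[B] x = 𝓝[B \ A] x := by
      rw [sdiff_eq, inter_comm]
      exact (nhdsWithin_inter_of_mem (nhdsWithin_le_nhds (hA.isOpen_compl.mem_nhds hxA))).symm
    have hFB : Forth R g (B \ A) x := (hg x hxB).1.mono sdiff_subset
    have hBB : Back R g (B \ A) x := fun w hw => hev ▸ (hg x hxB).2 w hw
    refine ⟨(Forth.of_notMem hA hxA).union ?_,
      (hBB.congr (eB ⟨hxB, hxA⟩) eB).mono (sdiff_subset.trans subset_union_right)⟩
    have := hFB.congr (eB ⟨hxB, hxA⟩) eB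
    rwa [Forth, ← hev] at this

end LocalConditions

section Packing

variable {E : Type*} [NormedAddCommGroup E] [NormedSpace ℝ E] [Nontrivial E]

/-- A point outside finitely many disjoint open balls contained in `V` (radius zero is allowed) is
a limit of points of `V` outside the corresponding closed balls. -/
theorem nonempty_diff_iUnion_closedBall {ι : Type*} {s : Set ι} (hs : s.Finite) {c : ι → E}
    {ρ : ι → ℝ} {V O : Set E} (hV : IsOpen V) (hO : IsOpen O)
    (hsV : ∀ i ∈ s, closedBall (c i) (ρ i) ⊆ V)
    (hd : s.PairwiseDisjoint fun i => closedBall (c i) (ρ i)) {x : E} (hxV : x ∈ closure V)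
    (hxO : x ∈ O) (hx : ∀ i ∈ s, x ∉ ball (c i) (ρ i)) :
    ((O ∩ V) \ ⋃ i ∈ s, closedBall (c i) (ρ i)).Nonempty := by
  by_cases hxs : ∃ i ∈ s, x ∈ closedBall (c i) (ρ i)
  · obtain ⟨i, his, hxi⟩ := hxs
    have hxG : x ∉ ⋃ j ∈ s \ {i}, closedBall (c j) (ρ j) := by
      simp only [mem_iUnion, not_exists]
      intro j hj hxj
      exact (hd hj.1 his hj.2).le_bot ⟨hxj, hxi⟩
    have hclosed : IsClosed (⋃ j ∈ s \ {i}, closedBall (c j) (ρ j)) :=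
      hs.sdiff.isClosed_biUnion fun _ _ => isClosed_closedBall
    have hcl : x ∈ closure (closedBall (c i) (ρ i))ᶜ := by
      rw [closure_compl, interior_closedBall']
      exact hx i his
    obtain ⟨y, ⟨⟨hyO, hyV⟩, hyG⟩, hyi⟩ := mem_closure_iff.1 hcl _
      ((hO.inter hV).inter hclosed.isOpen_compl) ⟨⟨hxO, hsV i his hxi⟩, hxG⟩
    refine ⟨y, ⟨hyO, hyV⟩, ?_⟩
    simp only [mem_iUnion, not_exists]
    intro j hj hyj
    by_cases hji : j = i
    · subst hji; exact hyi hyj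
    · exact hyG (mem_biUnion (show j ∈ s \ {i} from ⟨hj, hji⟩) hyj)
  · have hclosed : IsClosed (⋃ j ∈ s, closedBall (c j) (ρ j)) :=
      hs.isClosed_biUnion fun _ _ => isClosed_closedBall
    have hxG : x ∉ ⋃ j ∈ s, closedBall (c j) (ρ j) := by
      simp only [mem_iUnion, not_exists]
      exact fun j hj hxj => hxs ⟨j, hj, hxj⟩
    obtain ⟨y, ⟨hyO, hyG⟩, hyV⟩ := mem_closure_iff.1 hxV _ (hO.inter hclosed.isOpen_compl)
      ⟨hxO, hxG⟩
    exact ⟨y, ⟨hyO, hyV⟩, hyG⟩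

/-- An open set contains a family of pairwise disjoint labelled closed balls such that every
label occurs arbitrarily close to each point of its closure outside the open balls. Balls whose
label lies in `P` degenerate to points. -/
theorem exists_labelled_packing [SecondCountableTopology E] {L : Type*} [Finite L] [Nonempty L]
    (P : Set L) {V : Set E} (hV : IsOpen V) :
    ∃ F : Set (E × ℝ × L),
      (∀ b ∈ F, closedBall b.1 b.2.1 ⊆ V ∧ 0 ≤ b.2.1 ∧ (b.2.1 = 0 ↔ b.2.2 ∈ P)) ∧
      (F.PairwiseDisjoint fun b => closedBall b.1 b.2.1) ∧
      ∀ x ∈ closure V, (∀ b ∈ F, x ∉ ball b.1 b.2.1) → ∀ O, IsOpen O → x ∈ O → ∀ l,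
        ∃ b ∈ F, b.2.2 = l ∧ closedBall b.1 b.2.1 ⊆ O ∧ x ∉ closedBall b.1 b.2.1 := by
  classical
  let K : E × ℝ × L → Set E := fun b => closedBall b.1 b.2.1
  let Inv : Set (E × ℝ × L) → Prop := fun s =>
    s.Finite ∧ (∀ b ∈ s, K b ⊆ V ∧ 0 ≤ b.2.1 ∧ (b.2.1 = 0 ↔ b.2.2 ∈ P)) ∧ s.PairwiseDisjoint K
  let C := countableBasis E × L
  have step : ∀ (s : {s // Inv s}) (c : C), ∃ s' : {s // Inv s}, s.1 ⊆ s'.1 ∧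
      (((c.1.1 ∩ V) \ ⋃ b ∈ s.1, K b).Nonempty →
        ∃ b ∈ s'.1, b.2.2 = c.2 ∧ K b ⊆ c.1.1 \ ⋃ b ∈ s.1, K b) := by
    rintro ⟨s, hfin, hs, hd⟩ ⟨⟨O, hO⟩, l⟩
    by_cases hne : ((O ∩ V) \ ⋃ b ∈ s, K b).Nonempty
    · obtain ⟨p, hp⟩ := hne
      have hopen : IsOpen ((O ∩ V) \ ⋃ b ∈ s, K b) :=
        ((isOpen_of_mem_countableBasis hO).inter hV).sdiff
          (hfin.isClosed_biUnion fun _ _ => isClosed_closedBall)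
      obtain ⟨ε, hε, hεs⟩ := nhds_basis_closedBall.mem_iff.1 (hopen.mem_nhds hp)
      let ρ : ℝ := if l ∈ P then 0 else ε
      have hρ : 0 ≤ ρ ∧ ρ ≤ ε ∧ (ρ = 0 ↔ l ∈ P) := by
        by_cases hl : l ∈ P <;> simp [ρ, hl, hε.le, hε.ne']
      have hK : K (p, ρ, l) ⊆ (O ∩ V) \ ⋃ b ∈ s, K b :=
        (closedBall_subset_closedBall hρ.2.1).trans hεs
      refine ⟨⟨insert (p, ρ, l) s, hfin.insert _, ?_, ?_⟩, subset_insert _ _, fun _ =>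
        ⟨(p, ρ, l), mem_insert _ _, rfl, fun y hy => ⟨(hK hy).1.1, (hK hy).2⟩⟩⟩
      · rintro b (rfl | hb)
        · exact ⟨fun y hy => (hK hy).1.2, hρ.1, hρ.2.2⟩
        · exact hs b hb
      · refine hd.insert fun b hb _ => ?_
        rw [Set.disjoint_left]
        intro y hy hyb
        exact (hK hy).2 (mem_biUnion hb hyb)
    · exact ⟨⟨s, hfin, hs, hd⟩, Subset.rfl, fun h => absurd h hne⟩
  choose next hsub hnext using step
  have : Nonempty C := by
    obtain ⟨O, hO, -⟩ := (isBasis_countableBasis E).exists_subset_of_mem_open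
      (mem_univ (0 : E)) isOpen_univ
    exact ⟨⟨⟨O, hO⟩, Classical.arbitrary L⟩⟩
  obtain ⟨τ, hτ⟩ := exists_surjective_nat C
  let S : ℕ → {s // Inv s} := fun k =>
    Nat.rec ⟨∅, finite_empty, by simp, by simp⟩ (fun k s => next s (τ k.unpair.1)) k
  have hS : ∀ k, S (k + 1) = next (S k) (τ k.unpair.1) := fun _ => rfl
  have hmono : Monotone fun k => (S k).1 := monotone_nat_of_le_succ fun k => by
    simp only [hS]; exact hsub _ _
  have hdisj : (⋃ k, (S k).1).PairwiseDisjoint K :=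
    (pairwiseDisjoint_iUnion hmono.directed_le).2 fun k => (S k).2.2.2
  refine ⟨⋃ k, (S k).1, ?_, hdisj, ?_⟩
  · intro b hb
    obtain ⟨k, hk⟩ := mem_iUnion.1 hb
    exact (S k).2.2.1 b hk
  · intro x hxV hx O hO hxO l
    obtain ⟨O', hO', hxO', hsubO⟩ :=
      (isBasis_countableBasis E).exists_subset_of_mem_open hxO hO
    obtain ⟨i, hi⟩ := hτ (⟨O', hO'⟩, l)
    have key : ∀ j, ∃ b ∈ (S (Nat.pair i j + 1)).1, b.2.2 = l ∧
        K b ⊆ O' \ ⋃ b ∈ (S (Nat.pair i j)).1, K b := by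
      intro j
      have := hnext (S (Nat.pair i j)) (τ (Nat.pair i j).unpair.1)
      rw [← hS, Nat.unpair_pair, hi] at this
      exact this (nonempty_diff_iUnion_closedBall (S _).2.1 hV (isOpen_of_mem_countableBasis hO')
        (fun b hb => ((S _).2.2.1 b hb).1) (S _).2.2.2 hxV hxO'
        fun b hb => hx b (mem_iUnion.2 ⟨_, hb⟩))
    obtain ⟨b, hb, hbl, hbO⟩ := key 0
    by_cases hxb : x ∈ K b
    · obtain ⟨b', hb', hbl', hbO'⟩ := key (Nat.pair i 0 + 1)
      refine ⟨b', mem_iUnion.2 ⟨Nat.pair i (Nat.pair i 0 + 1) + 1, hb'⟩, hbl',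
        fun y hy => hsubO (hbO' hy).1, fun hxb' => ?_⟩
      exact (hbO' hxb').2 (mem_biUnion (hmono (Nat.right_le_pair _ _) hb) hxb)
    · exact ⟨b, mem_iUnion.2 ⟨Nat.pair i 0 + 1, hb⟩, hbl, fun y hy => hsubO (hbO hy).1, hxb⟩

end Packing

section Filling

variable {E W : Type*} [NormedAddCommGroup E] {R : W → W → Prop}

/-- Every open set carries a morphism into the points above `a` that looks like `a` from
outside and from the boundary. -/
def Fillable (R : W → W → Prop) (E : Type*) [NormedAddCommGroup E] (a : W) : Prop :=
  ∀ V : Set E, IsOpen V → ∃ f : E → W, (∀ x ∉ V, f x = a) ∧ (∀ x, R a (f x)) ∧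
    (∀ x, Forth R f univ x) ∧ ∀ x ∈ closure V, Back R f V x

/-- Every closed ball carries a morphism with value `u` exactly at the centre, values above `u`
elsewhere, and constant value `b` on the boundary. -/
def Pluggable (R : W → W → Prop) (E : Type*) [NormedAddCommGroup E] (u b : W) : Prop :=
  ∀ (q : E) (ρ : ℝ), 0 < ρ → ∃ f : E → W, f q = u ∧ (∀ x, dist x q = ρ → f x = b) ∧
    (∀ x ∈ closedBall q ρ, x ≠ q → R u (f x)) ∧ IsDMapOn R f (closedBall q ρ)

/-- Every open ball carries a morphism into `{w} ∪ R(w)` with value `w` at the centre. -/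
def OpenBallFillable (R : W → W → Prop) (E : Type*) [NormedAddCommGroup E] (w : W) : Prop :=
  ∀ (q : E) (ρ : ℝ), 0 < ρ → ∃ g : E → W, g q = w ∧ ∀ x ∈ ball q ρ,
    (g x = w ∨ R w (g x)) ∧ Forth R g (ball q ρ) x ∧ Back R g (ball q ρ) x

theorem Pluggable.openBallFillable {u b : W} (h : Pluggable R E u b) :
    OpenBallFillable R E u := by
  intro q ρ hρ
  obtain ⟨f, hfq, -, hfu, hf⟩ := h q ρ hρ
  refine ⟨f, hfq, fun x hx => ?_⟩
  have hx' := ball_subset_closedBall hx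
  refine ⟨?_, (hf x hx').1.mono ball_subset_closedBall, fun w hw => ?_⟩
  · by_cases hxq : x = q
    · exact Or.inl (hxq ▸ hfq)
    · exact Or.inr (hfu x hx' hxq)
  · rw [isOpen_ball.nhdsWithin_eq hx]
    exact ((hf x hx').2 w hw).filter_mono nhdsWithin_le_nhds

theorem Fillable.openBallFillable [NormedSpace ℝ E] [Nontrivial E] {a : W} (h : Fillable R E a) :
    OpenBallFillable R E a := by
  intro q ρ hρ
  obtain ⟨f, hfV, hfa, hF, hB⟩ := h (ball q ρ \ {q}) (isOpen_ball.sdiff isClosed_singleton)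
  refine ⟨f, hfV q (by simp), fun x hx => ⟨Or.inr (hfa x), (hF x).mono (subset_univ _),
    (hB x ?_).mono sdiff_subset⟩⟩
  have hdense : x ∈ closure ({q}ᶜ : Set E) := (dense_compl_singleton q) x
  exact isOpen_ball.inter_closure ⟨hx, hdense⟩

/-- A reflexive point is fillable as soon as every point strictly above it fills open balls. -/
theorem fillable_of_openBallFillable [NormedSpace ℝ E] [Nontrivial E] [SecondCountableTopology E]
    [Finite W] [IsTrans W R] {a : W} (ha : R a a)
    (h : ∀ w, R a w → ¬ R w a → OpenBallFillable R E w) : Fillable R E a := by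
  classical
  intro V hV
  have : Nonempty {w // R a w} := ⟨⟨a, ha⟩⟩
  obtain ⟨F, hF, hd, hlim⟩ := exists_labelled_packing {w : {w // R a w} | R w.1 a} hV
  have hg : ∀ b : E × ℝ × {w // R a w}, ∃ g : E → W, b ∈ F → g b.1 = b.2.2.1 ∧
      ∀ x ∈ ball b.1 b.2.1,
        R a (g x) ∧ Forth R g (ball b.1 b.2.1) x ∧ Back R g (ball b.1 b.2.1) x := by
    rintro ⟨q, ρ, w, hw⟩
    by_cases hb : (q, ρ, (⟨w, hw⟩ : {w // R a w})) ∈ F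
    · obtain ⟨-, hρ, hP⟩ := hF _ hb
      rcases hρ.eq_or_lt with h0 | h0
      · obtain rfl : 0 = ρ := h0
        exact ⟨fun _ => w, fun _ => ⟨rfl, by simp⟩⟩
      · obtain ⟨g, hgq, hgx⟩ := h w hw (fun hwa => h0.ne' (hP.2 hwa)) q ρ h0
        refine ⟨g, fun _ => ⟨hgq, fun x hx => ⟨?_, (hgx x hx).2⟩⟩⟩
        rcases (hgx x hx).1 with e | e
        · rw [e]; exact hw
        · exact trans_of R hw e
    · exact ⟨fun _ => w, fun h => absurd h hb⟩
  choose g hgq hgb using hg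
  let core : E × ℝ × {w // R a w} → Set E := fun b => insert b.1 (ball b.1 b.2.1)
  have hcore : ∀ b ∈ F, core b ⊆ closedBall b.1 b.2.1 := by
    rintro b hb x (rfl | hx)
    · exact mem_closedBall_self (hF b hb).2.1
    · exact ball_subset_closedBall hx
  let f : E → W := fun x => if h : ∃ b ∈ F, x ∈ core b then g h.choose x else a
  have hf : ∀ b ∈ F, ∀ x ∈ core b, f x = g b x := by
    intro b hb x hx
    have hex : ∃ b ∈ F, x ∈ core b := ⟨b, hb, hx⟩
    have heq : hex.choose = b := hd.elim_set hex.choose_spec.1 hb x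
      (hcore _ hex.choose_spec.1 hex.choose_spec.2) (hcore _ hb hx)
    simp only [f, dif_pos hex, heq]
  have hf' : ∀ x, (¬ ∃ b ∈ F, x ∈ core b) → f x = a := fun x hx => by simp only [f, dif_neg hx]
  have hout : ∀ x, (∀ b ∈ F, x ∉ ball b.1 b.2.1) → R (f x) a ∧ R a (f x) := by
    intro x hx
    by_cases hex : ∃ b ∈ F, x ∈ core b
    · obtain ⟨b, hb, hxb⟩ := hex
      rw [hf b hb x hxb]
      obtain rfl : x = b.1 := hxb.resolve_right (hx b hb)
      have h0 : b.2.1 = 0 := by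
        by_contra hne
        exact hx b hb (mem_ball_self (lt_of_le_of_ne (hF b hb).2.1 (Ne.symm hne)))
      rw [hgq b hb]
      exact ⟨(hF b hb).2.2.1 h0, b.2.2.2⟩
    · rw [hf' x hex]
      exact ⟨ha, ha⟩
  have hRa : ∀ x, R a (f x) := by
    intro x
    by_cases hx : ∃ b ∈ F, x ∈ ball b.1 b.2.1
    · obtain ⟨b, hb, hxb⟩ := hx
      rw [hf b hb x (mem_insert_of_mem _ hxb)]
      exact (hgb b hb x hxb).1
    · push Not at hx
      exact (hout x hx).2
  refine ⟨f, fun x hx => hf' x ?_, hRa, fun x => ?_, fun x hxV => ?_⟩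
  · rintro ⟨b, hb, hxb⟩
    exact hx ((hF b hb).1 (hcore b hb hxb))
  · by_cases hx : ∃ b ∈ F, x ∈ ball b.1 b.2.1
    · obtain ⟨b, hb, hxb⟩ := hx
      have e : EqOn (g b) f (ball b.1 b.2.1) :=
        fun y hy => (hf b hb y (mem_insert_of_mem _ hy)).symm
      have := (hgb b hb x hxb).2.1.congr (e hxb) e
      rwa [Forth, isOpen_ball.nhdsWithin_eq hxb, ← nhdsWithin_univ] at this
    · push Not at hx
      exact Eventually.of_forall fun y _ => trans_of R (hout x hx).1 (hRa y)
  · by_cases hx : ∃ b ∈ F, x ∈ ball b.1 b.2.1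
    · obtain ⟨b, hb, hxb⟩ := hx
      have e : EqOn (g b) f (ball b.1 b.2.1) :=
        fun y hy => (hf b hb y (mem_insert_of_mem _ hy)).symm
      exact ((hgb b hb x hxb).2.2.congr (e hxb) e).mono
        (ball_subset_closedBall.trans (hF b hb).1)
    · push Not at hx
      intro w hw
      rw [frequently_nhdsWithin_iff, frequently_iff]
      intro U hU
      obtain ⟨O, hOU, hO, hxO⟩ := _root_.mem_nhds_iff.1 hU
      obtain ⟨b, hb, hbw, hbO, hxb⟩ := hlim x hxV hx O hO hxO ⟨w, trans_of R (hout x hx).2 hw⟩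
      have hc : b.1 ∈ closedBall b.1 b.2.1 := mem_closedBall_self (hF b hb).2.1
      refine ⟨b.1, hOU (hbO hc), ⟨fun e => hxb (e ▸ hc), ?_⟩, (hF b hb).1 hc⟩
      rw [hf b hb _ (mem_insert _ _), hgq b hb, hbw]

end Filling

section Shells

variable {E W : Type*} [NormedAddCommGroup E] {R : W → W → Prop} {T S S' : Set W} {a b c : W}

/-- The closed spherical shell with centre `q` and radii `s`, `t`. -/
def shell (q : E) (s t : ℝ) : Set E := {x | s ≤ dist x q ∧ dist x q ≤ t}

/-- The open spherical shell with centre `q` and radii `s`, `t`. -/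
def openShell (q : E) (s t : ℝ) : Set E := {x | s < dist x q ∧ dist x q < t}

theorem isClosed_shell (q : E) (s t : ℝ) : IsClosed (shell q s t) :=
  (isClosed_le continuous_const (continuous_id.dist continuous_const)).inter
    (isClosed_le (continuous_id.dist continuous_const) continuous_const)

theorem isOpen_openShell (q : E) (s t : ℝ) : IsOpen (openShell q s t) :=
  (isOpen_lt continuous_const (continuous_id.dist continuous_const)).inter
    (isOpen_lt (continuous_id.dist continuous_const) continuous_const)

theorem openShell_subset_shell (q : E) (s t : ℝ) : openShell q s t ⊆ shell q s t :=
  fun _ hx => ⟨hx.1.le, hx.2.le⟩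

theorem shell_union_shell (q : E) {s m t : ℝ} (hsm : s ≤ m) (hmt : m ≤ t) :
    shell q s m ∪ shell q m t = shell q s t := by
  ext x
  constructor
  · rintro (h | h)
    · exact ⟨h.1, h.2.trans hmt⟩
    · exact ⟨hsm.trans h.1, h.2⟩
  · intro h
    rcases le_total (dist x q) m with h' | h'
    · exact Or.inl ⟨h.1, h'⟩
    · exact Or.inr ⟨h', h.2⟩

theorem shell_subset_closure_openShell [NormedSpace ℝ E] [Nontrivial E] (q : E) {s t : ℝ}
    (hs : 0 ≤ s) (hst : s < t) : shell q s t ⊆ closure (openShell q s t) := by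
  intro x hx
  obtain ⟨e, he, hxe⟩ : ∃ e : E, ‖e‖ = 1 ∧ x = q + dist x q • e := by
    by_cases hxq : x = q
    · obtain ⟨e, he⟩ := exists_norm_eq E zero_le_one
      exact ⟨e, he, by simp [hxq]⟩
    · have hne : ‖x - q‖ ≠ 0 := norm_ne_zero_iff.2 (sub_ne_zero.2 hxq)
      refine ⟨‖x - q‖⁻¹ • (x - q), ?_, ?_⟩
      · rw [norm_smul, norm_inv, norm_norm, inv_mul_cancel₀ hne]
      · rw [dist_eq_norm, smul_smul, mul_inv_cancel₀ hne, one_smul, add_sub_cancel]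
  have hcont : Continuous fun r : ℝ => q + r • e := by fun_prop
  have hmem : dist x q ∈ closure (Ioo s t) := by
    rw [closure_Ioo hst.ne]; exact hx
  have hmaps : MapsTo (fun r : ℝ => q + r • e) (Ioo s t) (openShell q s t) := by
    intro r hr
    have : dist (q + r • e) q = r := by
      rw [dist_eq_norm, add_sub_cancel_left, norm_smul, he, mul_one, Real.norm_eq_abs,
        abs_of_nonneg (hs.trans hr.1.le)]
    exact ⟨by rw [this]; exact hr.1, by rw [this]; exact hr.2⟩
  rw [hxe]
  exact hmaps.closure hcont hmem

theorem exists_dist_eq [NormedSpace ℝ E] [Nontrivial E] (q : E) {s : ℝ} (hs : 0 ≤ s) :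
    ∃ x : E, dist x q = s := by
  obtain ⟨e, he⟩ := exists_norm_eq E hs
  exact ⟨q + e, by simp [he]⟩

/-- Morphisms on adjacent shells that agree on the common sphere glue. -/
theorem exists_glue_shell {q : E} {s m t : ℝ} (hsm : s ≤ m) (hmt : m ≤ t) {f g : E → W}
    (hf : IsDMapOn R f (shell q s m)) (hg : IsDMapOn R g (shell q m t))
    (hfm : ∀ x, dist x q = m → f x = b) (hgm : ∀ x, dist x q = m → g x = b) :
    ∃ h : E → W, IsDMapOn R h (shell q s t) ∧ EqOn h f (shell q s m) ∧ EqOn h g (shell q m t) := by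
  classical
  have hagree : ∀ x ∈ shell q s m ∩ shell q m t, f x = g x := fun x hx => by
    have := le_antisymm hx.1.2 hx.2.1
    rw [hfm x this, hgm x this]
  refine ⟨(shell q s m).piecewise f g, ?_, piecewise_eqOn _ _ _, fun x hx => ?_⟩
  · rw [← shell_union_shell q hsm hmt]
    exact IsDMapOn.glue (isClosed_shell _ _ _) (isClosed_shell _ _ _) hf hg
      fun x hx => Or.inl (hagree x hx)
  · by_cases hxm : x ∈ shell q s m
    · rw [piecewise_eq_of_mem _ _ _ hxm, hagree x ⟨hxm, hx⟩]
    · exact piecewise_eq_of_notMem _ _ _ hxm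

/-- Every shell carries a morphism into `T` that takes all values in `S`, is constantly `a` on the
inner sphere and constantly `b` on the outer one. -/
def Joins (R : W → W → Prop) (E : Type*) [NormedAddCommGroup E] (T S : Set W) (a b : W) : Prop :=
  ∀ (q : E) (s t : ℝ), 0 ≤ s → s < t → ∃ f : E → W, IsDMapOn R f (shell q s t) ∧
    MapsTo f (shell q s t) T ∧ S ⊆ f '' shell q s t ∧
    (∀ x, dist x q = s → f x = a) ∧ ∀ x, dist x q = t → f x = b

theorem Joins.mono {T' : Set W} (h : Joins R E T S a b) (hT : T ⊆ T') (hS : S' ⊆ S) :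
    Joins R E T' S' a b := by
  intro q s t hs hst
  obtain ⟨f, hf, hfT, hfS, hfa, hfb⟩ := h q s t hs hst
  exact ⟨f, hf, hfT.mono_right hT, hS.trans hfS, hfa, hfb⟩

theorem Joins.trans (h : Joins R E T S a b) (h' : Joins R E T S' b c) :
    Joins R E T (S ∪ S') a c := by
  intro q s t hs hst
  obtain ⟨m, hsm, hmt⟩ := exists_between hst
  obtain ⟨f, hf, hfT, hfS, hfa, hfb⟩ := h q s m hs hsm
  obtain ⟨g, hg, hgT, hgS, hgb, hgc⟩ := h' q m t (hs.trans hsm.le) hmt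
  obtain ⟨k, hk, hkf, hkg⟩ := exists_glue_shell hsm.le hmt.le hf hg hfb hgb
  have hU := shell_union_shell q hsm.le hmt.le
  refine ⟨k, hk, ?_, ?_, fun x hx => ?_, fun x hx => ?_⟩
  · rw [← hU]
    exact (hfT.congr hkf.symm).union (hgT.congr hkg.symm)
  · rw [← hU, image_union, hkf.image_eq, hkg.image_eq]
    exact union_subset_union hfS hgS
  · rw [hkf ⟨hx.ge, hx.le.trans hsm.le⟩, hfa x hx]
  · rw [hkg ⟨hmt.le.trans hx.ge, hx.le⟩, hgc x hx]

variable [NormedSpace ℝ E] [Nontrivial E]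

theorem Fillable.exists_shell (h : Fillable R E a) (q : E) {s t : ℝ} (hs : 0 ≤ s) (hst : s < t) :
    ∃ f : E → W, IsDMapOn R f (shell q s t) ∧ (∀ x, R a (f x)) ∧
      {w | R a w} ⊆ f '' shell q s t ∧
      (∀ x, dist x q = s → f x = a) ∧ ∀ x, dist x q = t → f x = a := by
  obtain ⟨f, hfV, hfa, hF, hB⟩ := h _ (isOpen_openShell q s t)
  have hcl := shell_subset_closure_openShell q hs hst
  have hin : ∀ x, dist x q = s → f x = a := fun x hx => hfV x fun h => h.1.ne' hx
  refine ⟨f, fun x hx => ⟨(hF x).mono (subset_univ _),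
    (hB x (hcl hx)).mono (openShell_subset_shell q s t)⟩, hfa, fun w hw => ?_, hin,
    fun x hx => hfV x fun h => h.2.ne hx⟩
  obtain ⟨x, hx⟩ := exists_dist_eq q hs
  have hfreq := hB x (hcl ⟨hx.ge, hx.le.trans hst.le⟩) w (by rwa [hin x hx])
  obtain ⟨y, ⟨-, hy⟩, hyV⟩ := (hfreq.and_eventually self_mem_nhdsWithin).exists
  exact ⟨y, openShell_subset_shell q s t hyV, hy⟩

theorem Fillable.joins (h : Fillable R E a) : Joins R E {w | R a w} {w | R a w} a a := by
  intro q s t hs hst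
  obtain ⟨f, hf, hfa, hfS, hfs, hft⟩ := h.exists_shell q hs hst
  exact ⟨f, hf, fun x _ => hfa x, hfS, hfs, hft⟩

theorem Fillable.joins_above [IsTrans W R]
    (ha : Fillable R E a) (hb : Fillable R E b) (hab : R a b) :
    Joins R E {w | R a w} ∅ a b := by
  classical
  intro q s t hs hst
  obtain ⟨m, hsm, hmt⟩ := exists_between hst
  obtain ⟨f, hf, hfa, -, hfs, hfm⟩ := ha.exists_shell q hs hsm
  obtain ⟨g, hg, hgb, -, hgm, hgt⟩ := hb.exists_shell q (hs.trans hsm.le) hmt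
  refine ⟨(shell q s m).piecewise f g, ?_, fun x _ => ?_, empty_subset _, fun x hx => ?_,
    fun x hx => ?_⟩
  · rw [← shell_union_shell q hsm.le hmt.le]
    refine IsDMapOn.glue (isClosed_shell _ _ _) (isClosed_shell _ _ _) hf hg
      fun x hx => Or.inr fun y _ => ?_
    rw [hfm x (le_antisymm hx.1.2 hx.2.1)]
    exact trans_of R hab (hgb y)
  · by_cases hx : x ∈ shell q s m
    · rw [piecewise_eq_of_mem _ _ _ hx]; exact hfa x
    · rw [piecewise_eq_of_notMem _ _ _ hx]; exact trans_of R hab (hgb x)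
  · rw [piecewise_eq_of_mem _ _ _ (show x ∈ shell q s m from ⟨hx.ge, hx.le.trans hsm.le⟩), hfs x hx]
  · rw [piecewise_eq_of_notMem _ _ _ fun h => (hmt.trans_eq hx.symm).not_ge h.2, hgt x hx]

theorem Fillable.joins_below [IsTrans W R]
    (ha : Fillable R E a) (hb : Fillable R E b) (hab : R a b) :
    Joins R E {w | R a w} ∅ b a := by
  classical
  intro q s t hs hst
  obtain ⟨m, hsm, hmt⟩ := exists_between hst
  obtain ⟨g, hg, hgb, -, hgs, hgm⟩ := hb.exists_shell q hs hsm
  obtain ⟨f, hf, hfa, -, hfm, hft⟩ := ha.exists_shell q (hs.trans hsm.le) hmt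
  refine ⟨(shell q m t).piecewise f g, ?_, fun x _ => ?_, empty_subset _, fun x hx => ?_,
    fun x hx => ?_⟩
  · rw [← shell_union_shell q hsm.le hmt.le, union_comm]
    refine IsDMapOn.glue (isClosed_shell _ _ _) (isClosed_shell _ _ _) hf hg
      fun x hx => Or.inr fun y _ => ?_
    rw [hfm x (le_antisymm hx.2.2 hx.1.1)]
    exact trans_of R hab (hgb y)
  · by_cases hx : x ∈ shell q m t
    · rw [piecewise_eq_of_mem _ _ _ hx]; exact hfa x
    · rw [piecewise_eq_of_notMem _ _ _ hx]; exact trans_of R hab (hgb x)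
  · rw [piecewise_eq_of_notMem _ _ _ fun h => (hx.trans_lt hsm).not_ge h.1, hgs x hx]
  · rw [piecewise_eq_of_mem _ _ _ (show x ∈ shell q m t from ⟨hmt.le.trans hx.ge, hx.le⟩), hft x hx]

/-- A ball carrying an isolated value `w` can be inserted into a shell filled by a point `z`
above `w`. -/
theorem Pluggable.exists_shell [IsTrans W R] {w z : W} (hwz : R w z)
    (h : Pluggable R E w z) (hz : Fillable R E z) (q : E) {s t : ℝ} (hs : 0 ≤ s) (hst : s < t) :
    ∃ (f : E → W) (p : E), IsDMapOn R f (shell q s t) ∧ p ∈ shell q s t ∧ f p = w ∧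
      (∀ x, x ≠ p → R w (f x)) ∧
      (∀ x, dist x q = s → f x = z) ∧ ∀ x, dist x q = t → f x = z := by
  classical
  obtain ⟨m, hsm, hmt⟩ := exists_between hst
  obtain ⟨p, hp⟩ := exists_dist_eq q (hs.trans hsm.le)
  have hpV : p ∈ openShell q s t := ⟨hp ▸ hsm, hp ▸ hmt⟩
  obtain ⟨ε, hε, hεV⟩ :=
    nhds_basis_closedBall.mem_iff.1 ((isOpen_openShell q s t).mem_nhds hpV)
  obtain ⟨g, hgp, hgz, hgw, hg⟩ := h p ε hε
  obtain ⟨f, hfV, hfz, hF, hB⟩ := hz (openShell q s t \ closedBall p ε)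
    ((isOpen_openShell q s t).sdiff isClosed_closedBall)
  have hfA : IsDMapOn R f (shell q s t \ ball p ε) := by
    intro x hx
    have hmem : x ∈ closure (openShell q s t \ closedBall p ε) := by
      rw [Set.sdiff_eq]
      by_cases hxp : x ∈ closedBall p ε
      · refine (isOpen_openShell q s t).inter_closure ⟨hεV hxp, ?_⟩
        rw [closure_compl, interior_closedBall']
        exact hx.2
      · rw [inter_comm]
        exact isClosed_closedBall.isOpen_compl.inter_closure
          ⟨hxp, shell_subset_closure_openShell q hs hst hx.1⟩
    exact ⟨(hF x).mono (subset_univ _), (hB x hmem).mono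
      (sdiff_subset_sdiff (openShell_subset_shell q s t) ball_subset_closedBall)⟩
  have hout : ∀ x ∉ openShell q s t, (closedBall p ε).piecewise g f x = z := fun x hx => by
    rw [piecewise_eq_of_notMem _ _ _ fun h => hx (hεV h), hfV x fun h => hx h.1]
  refine ⟨(closedBall p ε).piecewise g f, p, ?_, openShell_subset_shell q s t hpV, ?_, ?_,
    fun x hx => hout x fun h => h.1.ne' hx, fun x hx => hout x fun h => h.2.ne hx⟩
  · have hU : shell q s t = closedBall p ε ∪ (shell q s t \ ball p ε) := by
      ext x
      constructor
      · intro hx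
        by_cases hxp : x ∈ ball p ε
        · exact Or.inl (ball_subset_closedBall hxp)
        · exact Or.inr ⟨hx, hxp⟩
      · rintro (hx | hx)
        · exact openShell_subset_shell q s t (hεV hx)
        · exact hx.1
    rw [hU]
    refine IsDMapOn.glue isClosed_closedBall ((isClosed_shell q s t).sdiff isOpen_ball) hg hfA
      fun x hx => Or.inl ?_
    rw [hgz x (le_antisymm hx.1 (not_lt.1 hx.2.2)), hfV x fun h => h.2 hx.1]
  · rw [piecewise_eq_of_mem _ _ _ (mem_closedBall_self hε.le), hgp]
  · intro x hxp
    by_cases hx : x ∈ closedBall p ε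
    · rw [piecewise_eq_of_mem _ _ _ hx]
      exact hgw x hx hxp
    · rw [piecewise_eq_of_notMem _ _ _ hx]
      exact trans_of R hwz (hfz x)

end Shells

section Frames

variable {W : Type*} [Finite W] {R : W → W → Prop}

theorem wellFounded_strictlyAbove (R : W → W → Prop) [IsTrans W R] :
    WellFounded fun y x : W => R x y ∧ ¬ R y x := by
  have : IsTrans W fun y x : W => R x y ∧ ¬ R y x :=
    ⟨fun _ _ _ hab hbc => ⟨trans_of R hbc.1 hab.1, fun h => hab.2 (trans_of R h hbc.1)⟩⟩
  have : Std.Irrefl fun y x : W => R x y ∧ ¬ R y x := ⟨fun a h => h.2 h.1⟩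
  exact Finite.wellFounded_of_trans_of_irrefl _

theorem exists_reflexive_above [IsTrans W R]
    (hS : ∀ x : W, ∃ y, R x y) (x : W) : ∃ b, R x b ∧ R b b := by
  induction x using (wellFounded_strictlyAbove R).induction with
  | _ x ih =>
    obtain ⟨y, hxy⟩ := hS x
    by_cases hyx : R y x
    · exact ⟨y, hxy, trans_of R hyx hxy⟩
    · obtain ⟨b, hyb, hbb⟩ := ih y ⟨hxy, hyx⟩
      exact ⟨b, trans_of R hxy hyb, hbb⟩

/-- The reflexive points above an irreflexive point of a frame are connected with each other
through reflexive points. -/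
theorem reflexive_connected [IsTrans W R]
    (hS : ∀ x : W, ∃ y, R x y)
    (hK : ∀ x : W, ¬ R x x → ∀ y z, R x y → R x z → Relation.ReflTransGen
      (fun a b => (R a b ∨ R b a ∨ a = b) ∧ R x a ∧ R x b) y z)
    (u : W) (hu : ¬ R u u) {a b : W} (ha : R u a) (haa : R a a) (hb : R u b) (hbb : R b b) :
    Relation.ReflTransGen
      (fun a b => (R a b ∨ R b a) ∧ (R u a ∧ R a a) ∧ R u b ∧ R b b) a b := by
  induction u using (wellFounded_strictlyAbove R).induction generalizing a b with
  | _ u ih =>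
    have hlocal : ∀ y b c, R u y → R b b → R c c → (b = y ∨ R y b) → (c = y ∨ R y c) →
        Relation.ReflTransGen
          (fun a b => (R a b ∨ R b a) ∧ (R u a ∧ R a a) ∧ R u b ∧ R b b) b c := by
      intro y b c hy hbb hcc hyb hyc
      by_cases hyy : R y y
      · have hyb' : R y b := hyb.elim (fun e => e ▸ hyy) id
        have hyc' : R y c := hyc.elim (fun e => e ▸ hyy) id
        exact (Relation.ReflTransGen.single ⟨Or.inr hyb', ⟨trans_of R hy hyb', hbb⟩, hy, hyy⟩).tail
          ⟨Or.inl hyc', ⟨hy, hyy⟩, trans_of R hy hyc', hcc⟩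
      · have hyb' : R y b := hyb.resolve_left fun e => hyy (e ▸ hbb)
        have hyc' : R y c := hyc.resolve_left fun e => hyy (e ▸ hcc)
        refine Relation.ReflTransGen.mono ?_ _ _
          (ih y ⟨hy, fun h => hu (trans_of R hy h)⟩ hyy hyb' hbb hyc' hcc)
        rintro p q ⟨h, ⟨hp, hpp⟩, hq, hqq⟩
        exact ⟨h, ⟨trans_of R hy hp, hpp⟩, trans_of R hy hq, hqq⟩
    have hchain : ∀ z, Relation.ReflTransGen
        (fun a b => (R a b ∨ R b a ∨ a = b) ∧ R u a ∧ R u b) a z →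
        ∀ c, R c c → (c = z ∨ R z c) → Relation.ReflTransGen
          (fun a b => (R a b ∨ R b a) ∧ (R u a ∧ R a a) ∧ R u b ∧ R b b) a c := by
      intro z hz
      induction hz with
      | refl => exact fun c hcc hc => hlocal a a c ha haa hcc (Or.inl rfl) hc
      | @tail z z' _ hzz' ihz =>
        intro c hcc hc
        obtain ⟨h | h | rfl, hz, hz'⟩ := hzz'
        · exact ihz c hcc (Or.inr (hc.elim (fun e => e ▸ h) (trans_of R h)))
        · obtain ⟨d, hzd, hdd⟩ := exists_reflexive_above hS z
          exact (ihz d hdd (Or.inr hzd)).trans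
            (hlocal z' d c hz' hdd hcc (Or.inr (trans_of R h hzd)) hc)
        · exact ihz c hcc hc
    exact hchain b (hK u hu a b ha hb) b hbb (Or.inl rfl)

end Frames

section Accumulation

variable {E W : Type*} [NormedAddCommGroup E] {R : W → W → Prop}

/-- Shells accumulating at a point glue to a morphism on the ball around it. -/
theorem pluggable_of_joins {u b : W} (h : Joins R E {w | R u w} {w | R u w} b b) :
    Pluggable R E u b := by
  classical
  intro q ρ hρ
  let r : ℕ → ℝ := fun k => ρ / 2 ^ k
  have hr0 : ∀ k, 0 < r k := fun k => by positivity
  have hranti : StrictAnti r := strictAnti_nat_of_succ_lt fun k => by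
    simp only [r, pow_succ]
    rw [div_lt_div_iff₀ (by positivity) (by positivity)]
    nlinarith [mul_pos hρ (pow_pos (two_pos (α := ℝ)) k)]
  have hlim : Tendsto r atTop (𝓝 0) := by
    have := (tendsto_pow_atTop_nhds_zero_of_lt_one (r := (2⁻¹ : ℝ)) (by norm_num)
      (by norm_num)).const_mul ρ
    simpa [r, div_eq_mul_inv] using this
  have hr_zero : r 0 = ρ := by simp [r]
  let A : ℕ → Set E := fun k => shell q (r (k + 1)) (r k)
  choose g hgD hgM hgS hgin hgout using fun k =>
    h q (r (k + 1)) (r k) (hr0 _).le (hranti k.lt_succ_self)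
  have hnq : ∀ k, ∀ x ∈ A k, x ≠ q := fun k x hx e =>
    (hr0 (k + 1)).not_ge (by simpa [e] using hx.1)
  have hcover : ∀ N x, dist x q ≤ ρ → r N < dist x q → ∃ k < N, x ∈ A k := by
    intro N x hxρ hxN
    have hex : ∃ k, r k < dist x q := ⟨N, hxN⟩
    obtain ⟨k, hk⟩ : ∃ k, Nat.find hex = k + 1 := Nat.exists_eq_succ_of_ne_zero fun h0 => by
      have := Nat.find_spec hex
      rw [h0, hr_zero] at this
      exact this.not_ge hxρ
    have hspec := Nat.find_spec hex
    rw [hk] at hspec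
    have hle := Nat.find_min' hex hxN
    exact ⟨k, by omega, hspec.le, not_lt.1 (Nat.find_min hex (m := k) (by omega))⟩
  have hcover' : ∀ x ∈ closedBall q ρ, x ≠ q → ∃ k, x ∈ A k := by
    intro x hx hxq
    obtain ⟨N, hN⟩ := (hlim.eventually_lt_const (dist_pos.2 hxq)).exists
    obtain ⟨k, -, hk⟩ := hcover N x hx hN
    exact ⟨k, hk⟩
  let f : E → W := fun x => if h : ∃ k, x ∈ A k then g h.choose x else u
  have hagree : ∀ j k x, j < k → x ∈ A j → x ∈ A k → g j x = g k x := by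
    intro j k x hjk hj hk
    have h₁ : r k ≤ r (j + 1) := hranti.antitone hjk
    rw [hgin j x (le_antisymm (hk.2.trans h₁) hj.1), hgout k x (le_antisymm hk.2 (h₁.trans hj.1))]
  have hf : ∀ k, EqOn (g k) f (A k) := by
    intro k x hx
    have hex : ∃ k, x ∈ A k := ⟨k, hx⟩
    simp only [f, dif_pos hex]
    rcases lt_trichotomy k hex.choose with hlt | heq | hlt
    · exact hagree _ _ x hlt hx hex.choose_spec
    · rw [← heq]
    · exact (hagree _ _ x hlt hex.choose_spec hx).symm
  have hfq : f q = u := by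
    have : ¬ ∃ k, q ∈ A k := fun ⟨k, hk⟩ => hnq k q hk rfl
    simp only [f, dif_neg this]
  have hA : ∀ k, A k ⊆ closedBall q ρ := fun k x hx =>
    hx.2.trans (hr_zero ▸ hranti.antitone k.zero_le)
  have hfu : ∀ x ∈ closedBall q ρ, x ≠ q → R u (f x) := by
    intro x hx hxq
    obtain ⟨k, hk⟩ := hcover' x hx hxq
    rw [← hf k hk]
    exact hgM k hk
  refine ⟨f, hfq, fun x hx => ?_, hfu, fun x hx => ?_⟩
  · have hx0 : x ∈ A 0 := ⟨hx ▸ hr_zero ▸ (hranti Nat.zero_lt_one).le, (hx.trans hr_zero.symm).le⟩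
    rw [← hf 0 hx0, hgout 0 x (hx.trans hr_zero.symm)]
  · by_cases hxq : x = q
    · subst hxq
      refine ⟨?_, fun w hw => ?_⟩
      · filter_upwards [self_mem_nhdsWithin] with y hy hyq
        rw [hfq]
        exact hfu y hy hyq
      · rw [hfq] at hw
        rw [frequently_nhdsWithin_iff, frequently_iff]
        intro U hU
        obtain ⟨ε, hε, hεU⟩ := Metric.mem_nhds_iff.1 hU
        obtain ⟨k, hk⟩ := (hlim.eventually_lt_const hε).exists
        obtain ⟨y, hy, hyw⟩ := hgS k hw
        exact ⟨y, hεU (hy.2.trans_lt hk), ⟨hnq k y hy, by rw [← hf k hy, hyw]⟩, hA k hy⟩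
    · obtain ⟨k, hk⟩ := hcover' x hx hxq
      refine ⟨?_, ((hgD k x hk).2.congr (hf k hk) (hf k)).mono (hA k)⟩
      have hforth : ∀ N, Forth R f (⋃ j ∈ Finset.range N, A j) x := by
        intro N
        induction N with
        | zero => simp [Forth]
        | succ N ih =>
          rw [Finset.range_add_one, Finset.set_biUnion_insert]
          refine Forth.union ?_ ih
          by_cases hxN : x ∈ A N
          · exact (hgD N x hxN).1.congr (hf N hxN) (hf N)
          · exact Forth.of_notMem (isClosed_shell _ _ _) hxN
      obtain ⟨N, hN⟩ := (hlim.eventually_lt_const (dist_pos.2 hxq)).exists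
      have hnear : ∀ᶠ y in 𝓝[closedBall q ρ] x, r N < dist y q :=
        nhdsWithin_le_nhds ((continuous_id.dist continuous_const).continuousAt.eventually
          (lt_mem_nhds hN))
      have hforth' := nhdsWithin_le_nhds (s := closedBall q ρ)
        (eventually_nhdsWithin_iff.1 (hforth N))
      filter_upwards [hnear, hforth', self_mem_nhdsWithin] with y hy hy' hyρ
      obtain ⟨j, hj, hyj⟩ := hcover N y hyρ hy
      exact hy' (mem_biUnion (Finset.mem_coe.2 (Finset.mem_range.2 hj)) hyj)

end Accumulation

section Construction

variable {E W : Type*} [NormedAddCommGroup E] [NormedSpace ℝ E] [Nontrivial E] [Finite W]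
  {R : W → W → Prop}

/-- Above an irreflexive point `u`, any two reflexive points can be joined by a morphism onto the
set of points above `u`. -/
theorem joins_above_irreflexive [IsTrans W R]
    (hS : ∀ x : W, ∃ y, R x y)
    (hK : ∀ x : W, ¬ R x x → ∀ y z, R x y → R x z → Relation.ReflTransGen
      (fun a b => (R a b ∨ R b a ∨ a = b) ∧ R x a ∧ R x b) y z)
    {u : W} (hu : ¬ R u u) (hfill : ∀ a, R u a → R a a → Fillable R E a)
    (hplug : ∀ w, R u w → ¬ R w w → ∀ z, R w z → R z z → Pluggable R E w z)
    {a b : W} (ha : R u a) (haa : R a a) (hb : R u b) (hbb : R b b) :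
    Joins R E {w | R u w} {w | R u w} a b := by
  have hup : ∀ {c}, R u c → {w | R c w} ⊆ {w | R u w} := fun hc w hw => trans_of R hc hw
  have hpath : ∀ {a b}, R u a → R a a → R u b → R b b → Joins R E {w | R u w} ∅ a b := by
    intro a b ha haa hb hbb
    have := reflexive_connected hS hK u hu ha haa hb hbb
    induction this with
    | refl => exact (hfill a ha haa).joins.mono (hup ha) (empty_subset _)
    | tail _ h ih =>
      obtain ⟨h | h, ⟨hc, hcc⟩, hd, hdd⟩ := h
      · exact ((ih hc hcc).trans (((hfill _ hc hcc).joins_above (hfill _ hd hdd) h).mono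
          (hup hc) Subset.rfl)).mono Subset.rfl (empty_subset _)
      · exact ((ih hc hcc).trans (((hfill _ hd hdd).joins_below (hfill _ hc hcc) h).mono
          (hup hd) Subset.rfl)).mono Subset.rfl (empty_subset _)
  have hhit : ∀ w, R u w → ∃ z, R u z ∧ R z z ∧ Joins R E {w | R u w} {w} z z := by
    intro w hw
    by_cases hww : R w w
    · exact ⟨w, hw, hww, (hfill w hw hww).joins.mono (hup hw) (singleton_subset_iff.2 hww)⟩
    · obtain ⟨z, hwz, hzz⟩ := exists_reflexive_above hS w
      refine ⟨z, trans_of R hw hwz, hzz, fun q s t hs hst => ?_⟩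
      obtain ⟨f, p, hf, hp, hfp, hfw, hfs, hft⟩ :=
        (hplug w hw hww z hwz hzz).exists_shell hwz (hfill z (trans_of R hw hwz) hzz) q hs hst
      refine ⟨f, hf, fun x _ => ?_, singleton_subset_iff.2 ⟨p, hp, hfp⟩, hfs, hft⟩
      by_cases hxp : x = p
      · rw [hxp, hfp]; exact hw
      · exact trans_of R hw (hfw x hxp)
  have hall : ∀ S : Set W, S ⊆ {w | R u w} → Joins R E {w | R u w} S a b := by
    intro S
    induction S, S.toFinite using Set.Finite.induction_on with
    | empty => exact fun _ => hpath ha haa hb hbb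
    | @insert w S _ _ ih =>
      intro hsub
      obtain ⟨z, hz, hzz, hj⟩ := hhit w (hsub (mem_insert w S))
      have hbS := ih ((subset_insert w S).trans hsub)
      refine ((((hpath ha haa hz hzz).trans hj).trans (hpath hz hzz ha haa)).trans hbS).mono
        Subset.rfl ?_
      rintro x (rfl | hx)
      · exact Or.inl (Or.inl (Or.inr rfl))
      · exact Or.inr hx
  exact hall _ Subset.rfl

theorem fillable_and_pluggable [SecondCountableTopology E]
    [IsTrans W R] (hS : ∀ x : W, ∃ y, R x y)
    (hK : ∀ x : W, ¬ R x x → ∀ y z, R x y → R x z → Relation.ReflTransGen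
      (fun a b => (R a b ∨ R b a ∨ a = b) ∧ R x a ∧ R x b) y z) (u : W) :
    (R u u → Fillable R E u) ∧ (¬ R u u → ∀ b, R u b → R b b → Pluggable R E u b) := by
  induction u using (wellFounded_strictlyAbove R).induction with
  | _ u ih =>
    constructor
    · intro huu
      refine fillable_of_openBallFillable huu fun w huw hwu => ?_
      by_cases hww : R w w
      · exact ((ih w ⟨huw, hwu⟩).1 hww).openBallFillable
      · obtain ⟨z, hwz, hzz⟩ := exists_reflexive_above hS w
        exact ((ih w ⟨huw, hwu⟩).2 hww z hwz hzz).openBallFillable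
    · intro huu b hub hbb
      have hirr : ∀ {w}, R u w → ¬ R w u := fun h h' => huu (trans_of R h h')
      exact pluggable_of_joins (joins_above_irreflexive hS hK huu
        (fun a hua => (ih a ⟨hua, hirr hua⟩).1) (fun w huw => (ih w ⟨huw, hirr huw⟩).2)
        hub hbb hub hbb)

end Construction

section Assembly

theorem derivedSet_preimage_of_isDMapOn {E W : Type*} [TopologicalSpace E] {R : W → W → Prop}
    {f : E → W} {X : Set E} (h : IsDMapOn R f X) (w : W) :
    derivedSet ((fun x : X => f x) ⁻¹' {w}) = (fun x : X => f x) ⁻¹' {v | R v w} := by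
  ext x
  have hiff : x ∈ derivedSet ((fun x : X => f x) ⁻¹' {w}) ↔
      ∃ᶠ y in 𝓝[X] (x : E), y ≠ (x : E) ∧ f y = w := by
    rw [mem_derivedSet, accPt_iff_frequently, ← map_nhds_subtype_val, frequently_map]
    simp [Subtype.ext_iff]
  rw [hiff]
  constructor
  · intro hfreq
    obtain ⟨y, ⟨hne, rfl⟩, hy⟩ := (hfreq.and_eventually (h x x.2).1).exists
    exact hy hne
  · exact (h x x.2).2 w

variable {E W : Type*} [NormedAddCommGroup E] [NormedSpace ℝ E] [Nontrivial E]
  [SecondCountableTopology E] [Finite W] {R RD : W → W → Prop} {w' w'' r : W}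

/-- For an irreflexive root, a shell carries a morphism taking the root as a value exactly once. -/
theorem exists_shell_map_root_once [IsTrans W R] (hF : IsDT1CKFrame R RD) (hr : ¬ R r r)
    (hw' : R w' w') (hw'' : R w'' w'') (hrw' : R r w') (hrw'' : R r w'')
    (q : E) {s t : ℝ} (hs : 0 ≤ s) (hst : s < t) :
    ∃ (f : E → W) (p : E), IsDMapOn R f (shell q s t) ∧ p ∈ shell q s t ∧ f p = r ∧
      (∀ x ∈ shell q s t, x ≠ p → R r (f x)) ∧
      (∀ x, dist x q = s → f x = w') ∧ ∀ x, dist x q = t → f x = w'' := by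
  have hmain := fillable_and_pluggable (E := E) hF.serial hF.ku
  obtain ⟨m, hsm, hmt⟩ := exists_between hst
  obtain ⟨f, p, hf, hp, hfp, hfr, hfs, hfm⟩ := ((hmain r).2 hr w' hrw' hw').exists_shell hrw'
    ((hmain w').1 hw') q hs hsm
  obtain ⟨g, hg, hgr, -, hgm, hgt⟩ := joins_above_irreflexive hF.serial hF.ku hr
    (fun a _ => (hmain a).1) (fun w _ => (hmain w).2) hrw' hw' hrw'' hw'' q m t
    (hs.trans hsm.le) hmt
  obtain ⟨k, hk, hkf, hkg⟩ := exists_glue_shell hsm.le hmt.le hf hg hfm hgm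
  refine ⟨k, p, hk, ⟨hp.1, hp.2.trans hmt.le⟩, by rw [hkf hp, hfp], fun x hx hxp => ?_,
    fun x hx => ?_, fun x hx => ?_⟩
  · rw [← shell_union_shell q hsm.le hmt.le] at hx
    rcases hx with hx | hx
    · rw [hkf hx]; exact hfr x hxp
    · rw [hkg hx]; exact hgr hx
  · rw [hkf ⟨hx.ge, hx.le.trans hsm.le⟩, hfs x hx]
  · rw [hkg ⟨hmt.le.trans hx.ge, hx.le⟩, hgt x hx]

/-- For an irreflexive root, a shell carries a morphism taking the root as a value at least
twice. -/
theorem exists_shell_map_root_twice [IsTrans W R] (hF : IsDT1CKFrame R RD) (hr : ¬ R r r)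
    (hw' : R w' w') (hw'' : R w'' w'') (hrw' : R r w') (hrw'' : R r w'')
    (q : E) {s t : ℝ} (hs : 0 ≤ s) (hst : s < t) :
    ∃ f : E → W, IsDMapOn R f (shell q s t) ∧
      (∃ p₁ ∈ shell q s t, ∃ p₂ ∈ shell q s t, p₁ ≠ p₂ ∧ f p₁ = r ∧ f p₂ = r) ∧
      (∀ x, dist x q = s → f x = w') ∧ ∀ x, dist x q = t → f x = w'' := by
  obtain ⟨m, hsm, hmt⟩ := exists_between hst
  obtain ⟨f, p₁, hf, hp₁, hfp, -, hfs, hfm⟩ :=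
    exists_shell_map_root_once hF hr hw' hw' hrw' hrw' q hs hsm
  obtain ⟨g, p₂, hg, hp₂, hgp, -, hgm, hgt⟩ :=
    exists_shell_map_root_once hF hr hw' hw'' hrw' hrw'' q (hs.trans hsm.le) hmt
  obtain ⟨k, hk, hkf, hkg⟩ := exists_glue_shell hsm.le hmt.le hf hg hfm hgm
  refine ⟨k, hk, ⟨p₁, ⟨hp₁.1, hp₁.2.trans hmt.le⟩, p₂, ⟨hsm.le.trans hp₂.1, hp₂.2⟩, ?_,
    by rw [hkf hp₁, hfp], by rw [hkg hp₂, hgp]⟩, fun x hx => ?_, fun x hx => ?_⟩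
  · rintro rfl
    exact hr (by simpa [← hfp, hfm p₁ (le_antisymm hp₁.2 hp₂.1)] using hw')
  · rw [hkf ⟨hx.ge, hx.le.trans hsm.le⟩, hfs x hx]
  · rw [hkg ⟨hmt.le.trans hx.ge, hx.le⟩, hgt x hx]

/-- For a reflexive root, a shell carries a morphism taking the root as a value. -/
theorem exists_shell_map_root_reflexive [IsTrans W R] (hF : IsDT1CKFrame R RD) (hr : R r r)
    (hw' : R w' w') (hw'' : R w'' w'') (hrw' : R r w') (hrw'' : R r w'')
    (q : E) {s t : ℝ} (hs : 0 ≤ s) (hst : s < t) :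
    ∃ f : E → W, IsDMapOn R f (shell q s t) ∧ (∃ p ∈ shell q s t, f p = r) ∧
      (∀ x, dist x q = s → f x = w') ∧ ∀ x, dist x q = t → f x = w'' := by
  have hmain := fun u => (fillable_and_pluggable (E := E) hF.serial hF.ku u).1
  obtain ⟨f, hf, -, hfS, hfs, hft⟩ := (((hmain r hr).joins_below (hmain w' hw') hrw').trans
    ((hmain r hr).joins.trans ((hmain r hr).joins_above (hmain w'' hw'') hrw''))) q s t hs hst
  exact ⟨f, hf, hfS (Or.inr (Or.inl hr)), hfs, hft⟩

/-- A shell carries a morphism onto a finite rooted frame which separates the points that are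
irreflexive for the difference relation, with prescribed values on the boundary spheres. -/
theorem exists_shell_map (hF : IsDT1CKFrame R RD) (hw' : R w' w') (hw'' : R w'' w'')
    (q : E) {s t : ℝ} (hs : 0 ≤ s) (hst : s < t) :
    ∃ f : E → W, IsDMapOn R f (shell q s t) ∧ (∀ w, ∃ x ∈ shell q s t, f x = w) ∧
      (∀ x ∈ shell q s t, ∀ y ∈ shell q s t, x ≠ y → RD (f x) (f y)) ∧
      (∀ x ∈ shell q s t, RD (f x) (f x) → ∃ y ∈ shell q s t, y ≠ x ∧ f y = f x) ∧
      (∀ x, dist x q = s → f x = w') ∧ ∀ x, dist x q = t → f x = w'' := by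
  have : IsTrans W R := ⟨fun _ _ _ h₁ h₂ => hF.trans h₁ h₂⟩
  obtain ⟨r, hroot⟩ := hF.rooted
  have hrefl : ∀ {w}, R w w → R r w := fun {w} hw => (hroot w).elim (fun e => e ▸ hw) id
  have hRD : ∀ {w}, R r w → RD w w := fun {w} hw => by
    by_contra hn
    exact hF.irrefl_min w hn r hw
  have hnear : ∀ {f : E → W}, IsDMapOn R f (shell q s t) → ∀ p ∈ shell q s t, f p = r →
      ∀ w, R r w → ∀ x ∈ shell q s t, (f x = w ∨ x = p) →
        ∃ y ∈ shell q s t, y ≠ x ∧ f y = w := by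
    intro f hf p hp hfp w hw x hx hxw
    have hfreq := ((hf p hp).2 w (hfp ▸ hw)).and_eventually self_mem_nhdsWithin
    by_cases hxp : x = p
    · obtain ⟨y, ⟨hy, hyw⟩, hyA⟩ := hfreq.exists
      exact ⟨y, hyA, hxp ▸ hy, hyw⟩
    · have hne : ∀ᶠ y in 𝓝[shell q s t] p, y ≠ x :=
        nhdsWithin_le_nhds (isOpen_ne.mem_nhds (Ne.symm hxp))
      obtain ⟨y, ⟨⟨-, hyw⟩, hyA⟩, hyx⟩ := (hfreq.and_eventually hne).exists
      exact ⟨y, hyA, hyx, hyw⟩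
  have hsurj : ∀ {f : E → W}, IsDMapOn R f (shell q s t) → ∀ p ∈ shell q s t, f p = r →
      ∀ w, ∃ x ∈ shell q s t, f x = w := by
    intro f hf p hp hfp w
    rcases hroot w with rfl | hw
    · exact ⟨p, hp, hfp⟩
    · obtain ⟨y, hy, -, hyw⟩ := hnear hf p hp hfp w hw p hp (Or.inr rfl)
      exact ⟨y, hy, hyw⟩
  by_cases hr : R r r
  · obtain ⟨f, hf, ⟨p, hp, hfp⟩, hfs, hft⟩ :=
      exists_shell_map_root_reflexive hF hr hw' hw'' (hrefl hw') (hrefl hw'') q hs hst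
    have hall : ∀ w, R r w := fun w => (hroot w).elim (fun e => e ▸ hr) id
    refine ⟨f, hf, hsurj hf p hp hfp, fun x _ y _ _ => ?_, fun x hx _ =>
      hnear hf p hp hfp _ (hall _) x hx (Or.inl rfl), hfs, hft⟩
    by_cases hxy : f x = f y
    · rw [← hxy]; exact hRD (hall _)
    · exact hF.diff _ _ hxy
  · by_cases hrD : RD r r
    · obtain ⟨f, hf, ⟨p₁, hp₁, p₂, hp₂, hne, hfp₁, hfp₂⟩, hfs, hft⟩ :=
        exists_shell_map_root_twice hF hr hw' hw'' (hrefl hw') (hrefl hw'') q hs hst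
      refine ⟨f, hf, hsurj hf p₁ hp₁ hfp₁, fun x _ y _ _ => ?_, fun x hx _ => ?_, hfs, hft⟩
      · by_cases hxy : f x = f y
        · rw [← hxy]
          rcases hroot (f x) with h | h
          · rw [h]; exact hrD
          · exact hRD h
        · exact hF.diff _ _ hxy
      · rcases hroot (f x) with h | h
        · by_cases hxp : p₁ = x
          · exact ⟨p₂, hp₂, hxp ▸ hne.symm, by rw [h, hfp₂]⟩
          · exact ⟨p₁, hp₁, hxp, by rw [h, hfp₁]⟩
        · exact hnear hf p₁ hp₁ hfp₁ _ h x hx (Or.inl rfl)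
    · obtain ⟨f, p, hf, hp, hfp, hfr, hfs, hft⟩ :=
        exists_shell_map_root_once hF hr hw' hw'' (hrefl hw') (hrefl hw'') q hs hst
      refine ⟨f, hf, hsurj hf p hp hfp, fun x hx y hy hne => ?_, fun x hx hxD => ?_, hfs, hft⟩
      · by_cases hxy : f x = f y
        · by_cases hxp : x = p
          · have := hRD (hfr y hy fun e => hne (hxp.trans e.symm))
            rwa [hxy]
          · have := hRD (hfr x hx hxp)
            rwa [← hxy]
        · exact hF.diff _ _ hxy
      · rcases hroot (f x) with h | h
        · exact absurd (h ▸ hxD) hrD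
        · exact hnear hf p hp hfp _ h x hx (Or.inl rfl)

end Assembly

end ShellMorphism

/-- for `n ≥ 2` and `0 ≤ r₁ < r₂`, the spherical shell
`{x ∈ ℝⁿ : r₁ ≤ ‖x‖ ≤ r₂}` admits a dd-morphism onto any finite rooted
DT1CK-frame, sending the inner boundary sphere to a prescribed `R`-reflexive
point `w'` and the outer one to a prescribed `R`-reflexive point `w''`. -/
theorem ddMorphism_from_shell_onto_DT1CK_frame
    (n : ℕ) (hn : 2 ≤ n) (r₁ r₂ : ℝ) (h0 : 0 ≤ r₁) (h12 : r₁ < r₂)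
    {W : Type*} [Finite W] [Nonempty W] (R RD : W → W → Prop)
    (hF : IsDT1CKFrame R RD)
    (w' w'' : W) (hw' : R w' w') (hw'' : R w'' w'') :
    ∃ f : ({x : EuclideanSpace ℝ (Fin n) | r₁ ≤ ‖x‖ ∧ ‖x‖ ≤ r₂}) → W,
      Function.Surjective f ∧
      (∀ w, derivedSet (f ⁻¹' {w}) = f ⁻¹' {v | R v w}) ∧
      (∀ x y, x ≠ y → RD (f x) (f y)) ∧
      (∀ x w, RD (f x) w → ∃ y, y ≠ x ∧ f y = w) ∧
      f '' {x | ‖(x : EuclideanSpace ℝ (Fin n))‖ = r₁} = {w'} ∧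
      f '' {x | ‖(x : EuclideanSpace ℝ (Fin n))‖ = r₂} = {w''} := by
  have : Nontrivial (EuclideanSpace ℝ (Fin n)) := by
    have : Nonempty (Fin n) := ⟨⟨0, by omega⟩⟩
    infer_instance
  obtain ⟨f, hf, hsurj, hne, htwo, hin, hout⟩ := ShellMorphism.exists_shell_map hF hw' hw''
    (0 : EuclideanSpace ℝ (Fin n)) h0 h12
  have hX : ShellMorphism.shell (0 : EuclideanSpace ℝ (Fin n)) r₁ r₂ =
      {x | r₁ ≤ ‖x‖ ∧ ‖x‖ ≤ r₂} := by
    ext x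
    simp [ShellMorphism.shell]
  rw [hX] at hf hsurj hne htwo
  have hsphere : ∀ (ρ : ℝ) (w : W), r₁ ≤ ρ → ρ ≤ r₂ →
      (∀ x : EuclideanSpace ℝ (Fin n), dist x 0 = ρ → f x = w) →
      (fun x : {x : EuclideanSpace ℝ (Fin n) | r₁ ≤ ‖x‖ ∧ ‖x‖ ≤ r₂} => f x) ''
        {x | ‖(x : EuclideanSpace ℝ (Fin n))‖ = ρ} = {w} := by
    intro ρ w h₁ h₂ hw
    have hval : ∀ x : EuclideanSpace ℝ (Fin n), ‖x‖ = ρ → f x = w :=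
      fun x hx => hw x (by rwa [dist_zero_right])
    obtain ⟨e, he⟩ := exists_norm_eq (EuclideanSpace ℝ (Fin n)) (h0.trans h₁)
    refine Set.Subset.antisymm ?_ (Set.singleton_subset_iff.2
      ⟨⟨e, h₁.trans he.ge, he.le.trans h₂⟩, he, hval e he⟩)
    rintro _ ⟨x, hx, rfl⟩
    exact hval x hx
  refine ⟨fun x => f x, fun w => ?_, ShellMorphism.derivedSet_preimage_of_isDMapOn hf,
    fun x y hxy => hne x x.2 y y.2 fun e => hxy (Subtype.ext e), fun x w hxw => ?_,
    hsphere r₁ w' le_rfl h12.le hin, hsphere r₂ w'' h12.le le_rfl hout⟩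
  · obtain ⟨x, hx, hxw⟩ := hsurj w
    exact ⟨⟨x, hx⟩, hxw⟩
  · by_cases hw : f x = w
    · subst hw
      obtain ⟨y, hy, hyx, hyw⟩ := htwo x x.2 hxw
      exact ⟨⟨y, hy⟩, fun e => hyx (congrArg Subtype.val e), hyw⟩
    · obtain ⟨y, hy, hyw⟩ := hsurj w
      exact ⟨⟨y, hy⟩, fun e => hw (by rw [← hyw, ← e]), hyw⟩
end

section
/- Let X be a locally connected topological space in which every point is locally closed (for every x there is an open U ∋ x with closure({x}) ∩ U = {x}). Then the following are equivalent: (NSP) for every open preconnected set U, every x ∈ U such that U \ {x} is open, the set U \ {x} is preconnected; and (local 1-componency) for every x ∈ X and every neighbourhood U of x there exists a neighbourhood V of x with V ⊆ U and V \ {x} preconnected. -/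
/-- If an open separation of `U \ {x}` has one side containing a punctured neighbourhood of `x`,
then that side is everything, provided `U` is preconnected. -/
theorem IsPreconnected.diff_singleton_subset_of_nhds {X : Type*} [TopologicalSpace X]
    {U V A B : Set X} {x : X} (hU : IsPreconnected U) (hx : x ∈ U) (hUx : IsOpen (U \ {x}))
    (hA : IsOpen A) (hB : IsOpen B) (hcover : U \ {x} ⊆ A ∪ B)
    (hdisj : (U \ {x}) ∩ (A ∩ B) = ∅) (hV : V ∈ nhds x) (hVA : V \ {x} ⊆ A) :
    U \ {x} ⊆ A := by
  have hxV : x ∈ interior V := mem_interior_iff_mem_nhds.2 hV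
  have hIV : interior V ⊆ V := interior_subset
  have hsplit := isPreconnected_iff_subset_of_disjoint.1 hU
    (A ∩ (U \ {x}) ∪ interior V) (B ∩ (U \ {x})) ((hA.inter hUx).union isOpen_interior)
    (hB.inter hUx)
  have hcover' : U ⊆ (A ∩ (U \ {x}) ∪ interior V) ∪ B ∩ (U \ {x}) := by
    intro y hy
    by_cases hyx : y = x
    · subst hyx
      exact Or.inl (Or.inr hxV)
    · rcases hcover ⟨hy, hyx⟩ with h | h
      · exact Or.inl (Or.inl ⟨h, hy, hyx⟩)
      · exact Or.inr ⟨h, hy, hyx⟩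
  have hdisj' : U ∩ ((A ∩ (U \ {x}) ∪ interior V) ∩ (B ∩ (U \ {x}))) = ∅ := by
    refine Set.eq_empty_of_forall_notMem ?_
    rintro y ⟨-, hyA, hyB, hyU⟩
    refine Set.eq_empty_iff_forall_notMem.1 hdisj y ⟨hyU, ?_, hyB⟩
    rcases hyA with h | h
    · exact h.1
    · exact hVA ⟨hIV h, hyU.2⟩
  rcases hsplit hcover' hdisj' with h | h
  · intro y hy
    rcases h hy.1 with h | h
    · exact h.1
    · exact hVA ⟨hIV h, hy.2⟩
  · exact absurd rfl (h hx).2.2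

/-- in a locally connected space all of whose points are locally
closed, the non-splitting property (NSP) is equivalent to local
1-componency. -/
theorem nsp_iff_locally_one_component
    {X : Type*} [TopologicalSpace X] [LocallyConnectedSpace X]
    (hloc : ∀ x : X, ∃ U : Set X, IsOpen U ∧ x ∈ U ∧ closure {x} ∩ U = {x}) :
    (∀ U : Set X, IsOpen U → IsPreconnected U → ∀ x ∈ U,
        IsOpen (U \ {x}) → IsPreconnected (U \ {x})) ↔
    (∀ x : X, ∀ U ∈ nhds x, ∃ V ∈ nhds x, V ⊆ U ∧ IsPreconnected (V \ {x})) := by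
  constructor
  · intro hnsp x U hU
    obtain ⟨W, hWo, hxW, hW⟩ := hloc x
    obtain ⟨V, hVsub, hVo, hxV, hVc⟩ := locallyConnectedSpace_iff_subsets_isOpen_isConnected.1
      inferInstance x (U ∩ W) (Filter.inter_mem hU (hWo.mem_nhds hxW))
    have hVdiff : V \ {x} = V \ closure {x} := by
      ext y
      refine and_congr_right fun hy => not_congr ⟨fun h => subset_closure h, fun h => ?_⟩
      exact hW.subset ⟨h, (hVsub hy).2⟩
    refine ⟨V, hVo.mem_nhds hxV, fun y hy => (hVsub hy).1,
      hnsp V hVo hVc.isPreconnected x hxV ?_⟩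
    rw [hVdiff]
    exact hVo.sdiff isClosed_closure
  · intro hone U hUo hU x hx hUx
    obtain ⟨V, hV, hVU, hVc⟩ := hone x U (hUo.mem_nhds hx)
    rw [isPreconnected_iff_subset_of_disjoint]
    intro A B hA hB hcover hdisj
    have hVUx : V \ {x} ⊆ U \ {x} := Set.sdiff_subset_sdiff_left hVU
    rcases isPreconnected_iff_subset_of_disjoint.1 hVc A B hA hB (hVUx.trans hcover)
      (Set.subset_empty_iff.1 (hdisj ▸ Set.inter_subset_inter_left _ hVUx)) with h | h
    · exact Or.inl (hU.diff_singleton_subset_of_nhds hx hUx hA hB hcover hdisj hV h)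
    · exact Or.inr (hU.diff_singleton_subset_of_nhds hx hUx hB hA (Set.union_comm A B ▸ hcover)
        (Set.inter_comm A B ▸ hdisj) hV h)
end

section
/- Let (W,R) be a countable K4-frame: W countable nonempty and R transitive. Then there exist a subset Y ⊆ ℚ (with the subspace topology inherited from the rationals) and a d-morphism f : Y → W such that f⁻¹(w) is a singleton for every strictly R-minimal point w (every w with R⁻¹(w) = ∅). -/
/-- A d-morphism from a topological space onto a transitive Kripke frame `(W, R)`:
a surjective map which is continuous and open (w.r.t. the Alexandrov topology of
the reflexive closure of `R`), r-dense and i-discrete. -/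
def IsDMorphism {X : Type*} [TopologicalSpace X] {W : Type*}
    (R : W → W → Prop) (f : X → W) : Prop :=
  Function.Surjective f ∧
  (∀ x : X, ∃ U : Set X, IsOpen U ∧ x ∈ U ∧ ∀ y ∈ U, f y = f x ∨ R (f x) (f y)) ∧
  (∀ U : Set X, IsOpen U → ∀ x ∈ U, ∀ w, R (f x) w → ∃ z ∈ U, f z = w) ∧
  (∀ w, R w w → f ⁻¹' {w} ⊆ derivedSet (f ⁻¹' {w})) ∧
  (∀ w, ¬ R w w → f ⁻¹' {w} ∩ derivedSet (f ⁻¹' {w}) = ∅)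

/-- The rational with ternary digits `0` and `1` whose ones are separated by gaps given by the
entries of the list. -/
def ternaryCode : List ℕ → ℚ
  | [] => 0
  | a :: s => (1 / 3 : ℚ) ^ (a + 1) * (1 + ternaryCode s)

theorem ternaryCode_nonneg (s : List ℕ) : 0 ≤ ternaryCode s := by
  induction s with
  | nil => simp [ternaryCode]
  | cons a s ih => simp only [ternaryCode]; positivity

theorem ternaryCode_le_half (s : List ℕ) : ternaryCode s ≤ 1 / 2 := by
  induction s with
  | nil => simp [ternaryCode]
  | cons a s ih =>
    have h : (1 / 3 : ℚ) ^ (a + 1) ≤ 1 / 3 := by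
      simpa using pow_le_pow_of_le_one (by norm_num : (0 : ℚ) ≤ 1 / 3) (by norm_num)
        (Nat.le_add_left 1 a)
    have h0 := ternaryCode_nonneg s
    simp only [ternaryCode]
    nlinarith

theorem ternaryCode_append_singleton (s : List ℕ) (n : ℕ) :
    |ternaryCode (s ++ [n]) - ternaryCode s| ≤ (1 / 3 : ℚ) ^ (n + 1) := by
  induction s with
  | nil => simp [ternaryCode, abs_of_nonneg]
  | cons a s ih =>
    have h : (1 / 3 : ℚ) ^ (a + 1) ≤ 1 := pow_le_one₀ (by norm_num) (by norm_num)
    have hpos : (0 : ℚ) < (1 / 3 : ℚ) ^ (a + 1) := by positivity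
    have heq : ternaryCode (a :: s ++ [n]) - ternaryCode (a :: s) =
        (1 / 3 : ℚ) ^ (a + 1) * (ternaryCode (s ++ [n]) - ternaryCode s) := by
      simp only [List.cons_append, ternaryCode]; ring
    rw [heq, abs_mul, abs_of_pos hpos]
    exact (mul_le_of_le_one_left (abs_nonneg _) h).trans ih

/-- Lists whose codes are close enough to the code of `s` extend `s`. -/
theorem exists_prefix_of_ternaryCode_close (s : List ℕ) :
    ∃ ε : ℚ, 0 < ε ∧ ∀ t, |ternaryCode t - ternaryCode s| < ε → s <+: t := by
  induction s with
  | nil => exact ⟨1, one_pos, fun t _ => List.nil_prefix⟩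
  | cons a s ih =>
    obtain ⟨ε, hε, h⟩ := ih
    have hpos : (0 : ℚ) < (1 / 3 : ℚ) ^ (a + 1) := by positivity
    refine ⟨(1 / 3 : ℚ) ^ (a + 1) * min ε (1 / 2), by positivity, fun t ht => ?_⟩
    have hs0 := ternaryCode_nonneg s
    have hs1 := ternaryCode_le_half s
    have hhalf : |ternaryCode t - ternaryCode (a :: s)| < (1 / 3 : ℚ) ^ (a + 1) * (1 / 2) :=
      ht.trans_le (mul_le_mul_of_nonneg_left (min_le_right _ _) hpos.le)
    rw [abs_lt] at hhalf
    cases t with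
    | nil =>
      simp only [ternaryCode] at hhalf
      nlinarith [hhalf.1, mul_nonneg hpos.le hs0]
    | cons b t =>
      have ht0 := ternaryCode_nonneg t
      have ht1 := ternaryCode_le_half t
      have hbpos : (0 : ℚ) < (1 / 3 : ℚ) ^ (b + 1) := by positivity
      rcases lt_trichotomy b a with hba | rfl | hab
      · have hle : (1 / 3 : ℚ) ^ a ≤ (1 / 3 : ℚ) ^ (b + 1) :=
          pow_le_pow_of_le_one (by norm_num) (by norm_num) hba
        have hsucc : (1 / 3 : ℚ) ^ (a + 1) = (1 / 3 : ℚ) ^ a * (1 / 3) := pow_succ _ _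
        simp only [ternaryCode] at hhalf
        nlinarith [hhalf.2, mul_nonneg hbpos.le ht0,
          mul_nonneg hpos.le (sub_nonneg.2 hs1)]
      · have heq : ternaryCode (b :: t) - ternaryCode (b :: s) =
            (1 / 3 : ℚ) ^ (b + 1) * (ternaryCode t - ternaryCode s) := by
          simp only [ternaryCode]; ring
        rw [heq, abs_mul, abs_of_pos hpos] at ht
        have hlt := lt_of_mul_lt_mul_left ht hpos.le
        exact List.cons_prefix_cons.2 ⟨rfl, h t (hlt.trans_le (min_le_left _ _))⟩
      · have hle : (1 / 3 : ℚ) ^ (b + 1) ≤ (1 / 3 : ℚ) ^ (a + 1 + 1) :=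
          pow_le_pow_of_le_one (by norm_num) (by norm_num) (by omega)
        have hsucc : (1 / 3 : ℚ) ^ (a + 1 + 1) = (1 / 3 : ℚ) ^ (a + 1) * (1 / 3) := pow_succ _ _
        simp only [ternaryCode] at hhalf
        nlinarith [hhalf.1, mul_nonneg hpos.le hs0,
          mul_nonneg hbpos.le (sub_nonneg.2 ht1)]

theorem ternaryCode_injective : Function.Injective ternaryCode := by
  intro s t hst
  obtain ⟨ε, hε, h⟩ := exists_prefix_of_ternaryCode_close s
  obtain ⟨δ, hδ, h'⟩ := exists_prefix_of_ternaryCode_close t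
  have hpre : s <+: t := h t (by simpa [hst] using hε)
  have hpre' : t <+: s := h' s (by simpa [hst] using hδ)
  exact hpre.eq_of_length (le_antisymm hpre.length_le hpre'.length_le)

section Path

variable {W : Type*} (R : W → W → Prop) (e : ℕ → W)

/-- The last point of the path that starts at `w` and visits the points named by the list. -/
def pathEnd : W → List ℕ → W
  | w, [] => w
  | _, n :: l => pathEnd (e n) l

/-- The list names an `R`-path starting at `w`. -/
def IsPath : W → List ℕ → Prop
  | _, [] => True
  | w, n :: l => R w (e n) ∧ IsPath (e n) l

theorem pathEnd_append (w : W) (l r : List ℕ) :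
    pathEnd e w (l ++ r) = pathEnd e (pathEnd e w l) r := by
  induction l generalizing w with
  | nil => rfl
  | cons n l ih => exact ih (e n)

theorem isPath_append (w : W) (l r : List ℕ) :
    IsPath R e w (l ++ r) ↔ IsPath R e w l ∧ IsPath R e (pathEnd e w l) r := by
  induction l generalizing w with
  | nil => simp [IsPath, pathEnd]
  | cons n l ih => simp [IsPath, pathEnd, ih, and_assoc]

variable {R e}

theorem IsPath.rel_pathEnd (htrans : Transitive R) {w : W} {l : List ℕ}
    (h : IsPath R e w l) (hl : l ≠ []) : R w (pathEnd e w l) := by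
  induction l generalizing w with
  | nil => exact absurd rfl hl
  | cons n l ih =>
    cases l with
    | nil => exact h.1
    | cons m l => exact htrans h.1 (ih h.2 (by simp))

end Path

theorem exists_forall_exists_ge_eq (W : Type*) [Countable W] [Nonempty W] :
    ∃ e : ℕ → W, ∀ w N, ∃ n, N ≤ n ∧ e n = w := by
  obtain ⟨g, hg⟩ := exists_surjective_nat W
  refine ⟨fun n => g n.unpair.2, fun w N => ?_⟩
  obtain ⟨k, rfl⟩ := hg w
  exact ⟨Nat.pair N k, Nat.left_le_pair N k, by simp⟩

/-- A labelling of a set of rationals is a d-morphism as soon as points near `x` are labelled by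
`R`-successors of the label of `x`, and each such successor labels points arbitrarily near `x`. -/
theorem isDMorphism_of_labelled_range {X W : Type*} {R : W → W → Prop} {q : X → ℚ}
    (hq : Function.Injective q) {lab : X → W} (hsurj : Function.Surjective lab)
    (hnear : ∀ x, ∃ ε : ℚ, 0 < ε ∧ ∀ y, |q y - q x| < ε → y = x ∨ R (lab x) (lab y))
    (hsucc : ∀ x w, R (lab x) w → ∀ ε : ℚ, 0 < ε → ∃ y, y ≠ x ∧ |q y - q x| < ε ∧ lab y = w) :
    IsDMorphism R (lab ∘ (Equiv.ofInjective q hq).symm) := by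
  set E := Equiv.ofInjective q hq
  have hE : ∀ x, ((E x : Set.range q) : ℚ) = q x := fun x => rfl
  have hball : ∀ x (ε : ℚ), 0 < ε →
      ∃ U : Set (Set.range q), IsOpen U ∧ E x ∈ U ∧ ∀ y, E y ∈ U → |q y - q x| < ε := by
    intro x ε hε
    refine ⟨{y | |(y : ℚ) - q x| < ε}, ?_, by simpa [hE] using hε, fun y hy => hy⟩
    exact isOpen_lt (by fun_prop) continuous_const
  have hopen : ∀ x (U : Set (Set.range q)), IsOpen U → E x ∈ U →
      ∃ ε : ℚ, 0 < ε ∧ ∀ y, |q y - q x| < ε → E y ∈ U := by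
    intro x U hU hx
    obtain ⟨ε, hε, h⟩ := Metric.isOpen_iff.1 hU (E x) hx
    obtain ⟨δ, hδ, hδε⟩ := exists_rat_btwn hε
    refine ⟨δ, by exact_mod_cast hδ, fun y hy => h ?_⟩
    rw [Metric.mem_ball, Subtype.dist_eq, hE, hE, Rat.dist_eq]
    exact lt_trans (by exact_mod_cast hy) hδε
  refine ⟨hsurj.comp E.symm.surjective, ?_, ?_, ?_, ?_⟩
  · intro y
    obtain ⟨x, rfl⟩ := E.surjective y
    obtain ⟨ε, hε, h⟩ := hnear x
    obtain ⟨U, hU, hxU, hUε⟩ := hball x ε hε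
    refine ⟨U, hU, hxU, fun z hz => ?_⟩
    obtain ⟨z, rfl⟩ := E.surjective z
    rcases h z (hUε z hz) with rfl | hR
    · exact Or.inl rfl
    · exact Or.inr (by simpa using hR)
  · intro U hU y hy w hw
    obtain ⟨x, rfl⟩ := E.surjective y
    obtain ⟨ε, hε, h⟩ := hopen x U hU hy
    obtain ⟨z, -, hz, hlab⟩ := hsucc x w (by simpa using hw) ε hε
    exact ⟨E z, h z hz, by simpa using hlab⟩
  · intro w hw y hy
    obtain ⟨x, rfl⟩ := E.surjective y
    have hx : lab x = w := by simpa using hy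
    rw [mem_derivedSet, accPt_iff_nhds]
    intro V hV
    obtain ⟨U, hUV, hU, hxU⟩ := mem_nhds_iff.1 hV
    obtain ⟨ε, hε, h⟩ := hopen x U hU hxU
    obtain ⟨z, hne, hz, hlab⟩ := hsucc x w (by rwa [hx]) ε hε
    exact ⟨E z, ⟨hUV (h z hz), by simpa using hlab⟩, fun hzx => hne (E.injective hzx)⟩
  · intro w hw
    rw [Set.eq_empty_iff_forall_notMem]
    rintro y ⟨hy, hd⟩
    obtain ⟨x, rfl⟩ := E.surjective y
    have hx : lab x = w := by simpa using hy
    obtain ⟨ε, hε, h⟩ := hnear x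
    obtain ⟨U, hU, hxU, hUε⟩ := hball x ε hε
    rw [mem_derivedSet, accPt_iff_nhds] at hd
    obtain ⟨z, ⟨hzU, hzw⟩, hne⟩ := hd U (hU.mem_nhds hxU)
    obtain ⟨z, rfl⟩ := E.surjective z
    have hz : lab z = w := by simpa using hzw
    rcases h z (hUε z hzU) with rfl | hR
    · exact hne rfl
    · exact hw (by rwa [hx, hz] at hR)

/-- every countable K4-frame is a d-morphic image of a subspace
of the rationals, via a map which is 1-fold at all strictly minimal points. -/
theorem countable_K4_frame_dMorphic_image_of_rational_subspace
    {W : Type*} [Countable W] [Nonempty W] (R : W → W → Prop)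
    (htrans : Transitive R) :
    ∃ (Y : Set ℚ) (f : Y → W),
      IsDMorphism R f ∧
      (∀ w : W, {v | R v w} = ∅ → ∃ x : Y, f ⁻¹' {w} = {x}) := by
  obtain ⟨e, he⟩ := exists_forall_exists_ge_eq W
  obtain ⟨ι, hι⟩ := exists_injective_nat W
  let X := {p : W × List ℕ // IsPath R e p.1 p.2}
  let q : X → ℚ := fun p => ternaryCode (ι p.1.1 :: p.1.2)
  let lab : X → W := fun p => pathEnd e p.1.1 p.1.2
  have hq : Function.Injective q := by
    rintro ⟨⟨w, l⟩, h⟩ ⟨⟨w', l'⟩, h'⟩ heq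
    obtain ⟨h1, rfl⟩ := List.cons.inj (ternaryCode_injective heq)
    obtain rfl := hι h1
    rfl
  have hsurj : Function.Surjective lab := fun w => ⟨⟨(w, []), trivial⟩, rfl⟩
  refine ⟨Set.range q, lab ∘ (Equiv.ofInjective q hq).symm,
    isDMorphism_of_labelled_range hq hsurj ?_ ?_, ?_⟩
  · rintro ⟨⟨w, l⟩, h⟩
    obtain ⟨ε, hε, hpre⟩ := exists_prefix_of_ternaryCode_close (ι w :: l)
    refine ⟨ε, hε, ?_⟩
    rintro ⟨⟨w', l'⟩, h'⟩ hlt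
    obtain ⟨h1, r, rfl⟩ := List.cons_prefix_cons.1 (hpre _ hlt)
    obtain rfl := hι h1
    by_cases hr : r = []
    · subst hr
      exact Or.inl (Subtype.ext (by simp))
    · right
      change R (pathEnd e w l) (pathEnd e w (l ++ r))
      rw [pathEnd_append]
      exact ((isPath_append R e w l r).1 h').2.rel_pathEnd htrans hr
  · rintro ⟨⟨w, l⟩, h⟩ v hv ε hε
    obtain ⟨N, hN⟩ := exists_pow_lt_of_lt_one hε (by norm_num : (1 / 3 : ℚ) < 1)
    obtain ⟨n, hn, rfl⟩ := he v N
    refine ⟨⟨(w, l ++ [n]), (isPath_append R e w l [n]).2 ⟨h, hv, trivial⟩⟩, ?_, ?_, ?_⟩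
    · intro heq
      simpa using congrArg (fun p : X => p.1.2) heq
    · refine (ternaryCode_append_singleton (ι w :: l) n).trans_lt (lt_of_le_of_lt ?_ hN)
      exact pow_le_pow_of_le_one (by norm_num) (by norm_num) (by omega)
    · exact pathEnd_append e w l [n]
  · intro w hw
    refine ⟨Equiv.ofInjective q hq ⟨(w, []), trivial⟩, ?_⟩
    ext y
    obtain ⟨⟨⟨v, l⟩, h⟩, rfl⟩ := (Equiv.ofInjective q hq).surjective y
    simp only [Set.mem_preimage, Function.comp_apply, Equiv.symm_apply_apply,
      Set.mem_singleton_iff, EmbeddingLike.apply_eq_iff_eq]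
    constructor
    · rintro rfl
      cases l with
      | nil => rfl
      | cons n l =>
        exact absurd (h.rel_pathEnd htrans (by simp)) (Set.eq_empty_iff_forall_notMem.1 hw v)
    · intro heq
      rw [heq]
      rfl
end
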